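/- arXiv:2412.12319 — 3 statements merged into one kernel-verified Lean document; each statement's English description precedes it below -/
import Mathlib

section
/- Let f : ℝ → ℂ be integrable and bounded, and let ν be a finite Borel measure on ℝ such that f is continuous ν-almost everywhere. Define the transforms f̂(t) = ∫_ℝ f(y) e^{ity} dy and ν̂(t) = ∫_ℝ e^{ity} dν(y). If the symmetric limit lim_{A→∞} ∫_{-A}^{A} f̂(t) ν̂(-t) dt exists, then ∫_ℝ f dν = (1/(2π)) · lim_{A→∞} ∫_{-A}^{A} f̂(t) ν̂(-t) dt. -/
open MeasureTheory Filter

lemma abel_S_bdd (G : ℝ → ℂ) (C : ℝ) (hGb : ∀ t, ‖G t‖ ≤ C) (L : ℂ)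
    (hlim : Tendsto (fun A : ℝ => ∫ t in (-A)..A, G t) atTop (nhds L)) :
    ∃ M : ℝ, ∀ A : ℝ, 0 ≤ A → ‖∫ t in (-A)..A, G t‖ ≤ M := by
  have h1 : ∀ᶠ A in atTop, ‖∫ t in (-A)..A, G t‖ ≤ ‖L‖ + 1 :=
    (hlim.norm.eventually (gt_mem_nhds (lt_add_one ‖L‖))).mono fun _ h => h.le
  obtain ⟨A0, hA0⟩ := eventually_atTop.1 h1
  have hC : 0 ≤ C := (norm_nonneg _).trans (hGb 0)
  refine ⟨max (‖L‖ + 1) (C * (2 * A0)), fun A hA => ?_⟩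
  rcases le_total A0 A with h | h
  · exact (hA0 A h).trans (le_max_left _ _)
  · refine le_trans ?_ (le_max_right _ _)
    have := intervalIntegral.norm_integral_le_of_norm_le_const (a := -A) (b := A) (f := G) (C := C)
      (fun x _ => hGb x)
    refine this.trans ?_
    rw [abs_of_nonneg (by linarith)]
    gcongr
    linarith

lemma abel_parts (G : ℝ → ℂ) (hG : Continuous G) (C : ℝ) (hGb : ∀ t, ‖G t‖ ≤ C)
    (M : ℝ) (hM : ∀ A : ℝ, 0 ≤ A → ‖∫ t in (-A)..A, G t‖ ≤ M) (b : ℝ) (hb : 0 < b) :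
    ∫ t : ℝ, G t * Complex.exp (-(b : ℂ) * (t : ℂ) ^ 2) =
      ∫ t in Set.Ioi (0 : ℝ), (∫ s in (-t)..t, G s) *
        (2 * b * (t * Complex.exp (-(b : ℂ) * (t : ℂ) ^ 2))) := by
  have hbre : 0 < (b : ℂ).re := by simpa using hb
  have hS : ∀ x : ℝ, HasDerivAt (fun A : ℝ => ∫ t in (-A)..A, G t) (G x + G (-x)) x := by
    intro x
    have e : (fun A : ℝ => ∫ t in (-A)..A, G t) =
        fun A => (∫ t in (0 : ℝ)..A, G t) - ∫ t in (0 : ℝ)..(-A), G t := by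
      ext A
      rw [intervalIntegral.integral_interval_sub_left] <;> exact hG.intervalIntegrable _ _
    rw [e]
    have h1 : ∀ y : ℝ, HasDerivAt (fun A : ℝ => ∫ t in (0 : ℝ)..A, G t) (G y) y :=
      fun y => hG.integral_hasStrictDerivAt 0 y |>.hasDerivAt
    have h2 := (h1 (-x)).scomp x (hasDerivAt_neg x)
    convert! (h1 x).sub h2 using 1
    simp
  have hv : ∀ x : ℝ, HasDerivAt (fun t : ℝ => Complex.exp (-(b : ℂ) * (t : ℂ) ^ 2))
      (-(2 * b * (x * Complex.exp (-(b : ℂ) * (x : ℂ) ^ 2)))) x := by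
    intro x
    have := (((hasDerivAt_pow 2 (x : ℂ)).const_mul (-(b : ℂ))).cexp).comp_ofReal
    convert! this using 1
    simp; ring
  have hgi := integrable_cexp_neg_mul_sq hbre
  have hgi' := integrable_mul_cexp_neg_mul_sq hbre
  have hSc : Continuous (fun A : ℝ => ∫ t in (-A)..A, G t) :=
    continuous_iff_continuousAt.2 fun x => (hS x).continuousAt
  have hGi : Integrable (fun t : ℝ => G t * Complex.exp (-(b : ℂ) * (t : ℂ) ^ 2)) :=
    hgi.bdd_mul hG.aestronglyMeasurable (Eventually.of_forall hGb)
  have hGi' : Integrable (fun t : ℝ => G (-t) * Complex.exp (-(b : ℂ) * (t : ℂ) ^ 2)) :=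
    hgi.bdd_mul (hG.comp continuous_neg).aestronglyMeasurable (Eventually.of_forall fun t => hGb _)
  have hlimv : Tendsto (fun t : ℝ => Complex.exp (-(b : ℂ) * (t : ℂ) ^ 2)) atTop (nhds 0) := by
    rw [tendsto_zero_iff_norm_tendsto_zero]
    simp_rw [norm_cexp_neg_mul_sq]
    refine Real.tendsto_exp_atBot.comp ?_
    exact Tendsto.const_mul_atTop_of_neg (by simpa using hb) (tendsto_pow_atTop two_ne_zero)
  have key := integral_Ioi_mul_deriv_eq_deriv_mul (a := 0) (a' := 0) (b' := 0)
    (fun x _ => hS x) (fun x _ => hv x) ?_ ?_ ?_ ?_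
  · rw [← intervalIntegral.integral_Iic_add_Ioi (b := 0) hGi.integrableOn hGi.integrableOn]
    have e := integral_comp_neg_Iic 0 (fun t : ℝ => G (-t) * Complex.exp (-(b : ℂ) * (t : ℂ) ^ 2))
    simp only [neg_neg, Complex.ofReal_neg, neg_sq, neg_zero] at e
    rw [e, add_comm, ← integral_add hGi.integrableOn hGi'.integrableOn]
    simp only [mul_neg, integral_neg, sub_zero, zero_sub, neg_inj] at key
    rw [key]
    simp only [add_mul]
  · refine Integrable.bdd_mul (c := M) (hgi'.const_mul _).neg.integrableOn
      hSc.aestronglyMeasurable ?_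
    filter_upwards [ae_restrict_mem measurableSet_Ioi] with x hx using hM x (le_of_lt hx)
  · refine ((hGi.add hGi').congr ?_).integrableOn
    filter_upwards with x
    simp [add_mul]
  · have : Tendsto ((fun A : ℝ => ∫ t in (-A)..A, G t) *
        fun t : ℝ => Complex.exp (-(b : ℂ) * (t : ℂ) ^ 2)) (nhds 0) (nhds 0) := by
      have := (hSc.mul (continuous_iff_continuousAt.2 fun x => (hv x).continuousAt)).tendsto 0
      simpa using this
    exact this.mono_left nhdsWithin_le_nhds
  · refine isBoundedUnder_le_mul_tendsto_zero ?_ hlimv |>.congr fun _ => rfl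
    refine ⟨M, ?_⟩
    rw [eventually_map]
    filter_upwards [eventually_ge_atTop 0] with x hx using hM x hx

lemma abel_lim (G : ℝ → ℂ) (hG : Continuous G) (C : ℝ) (hGb : ∀ t, ‖G t‖ ≤ C) (L : ℂ)
    (hlim : Tendsto (fun A : ℝ => ∫ t in (-A)..A, G t) atTop (nhds L)) :
    Tendsto (fun a : ℝ => ∫ t : ℝ, G t * Complex.exp (-(((a ^ 2)⁻¹ : ℝ) : ℂ) * (t : ℂ) ^ 2))
      atTop (nhds L) := by
  obtain ⟨M, hM⟩ := abel_S_bdd G C hGb L hlim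
  have hSm : Continuous (fun A : ℝ => ∫ t in (-A)..A, G t) := by
    have e : (fun A : ℝ => ∫ t in (-A)..A, G t) =
        fun A => (∫ t in (0 : ℝ)..A, G t) - ∫ t in (0 : ℝ)..(-A), G t := by
      ext A
      rw [intervalIntegral.integral_interval_sub_left] <;> exact hG.intervalIntegrable _ _
    rw [e]
    have h := intervalIntegral.continuous_primitive (fun a b => hG.intervalIntegrable a b) 0
      (μ := volume)
    exact h.sub (h.comp continuous_neg)
  have h1 : ∀ᶠ a : ℝ in atTop,
      ∫ u in Set.Ioi (0 : ℝ), (∫ s in (-(a * u))..(a * u), G s) *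
        (2 * (u * Complex.exp (-1 * (u : ℂ) ^ 2))) =
      ∫ t : ℝ, G t * Complex.exp (-(((a ^ 2)⁻¹ : ℝ) : ℂ) * (t : ℂ) ^ 2) := by
    filter_upwards [eventually_gt_atTop 0] with a ha
    rw [abel_parts G hG C hGb M hM _ (by positivity)]
    have := integral_comp_mul_left_Ioi' (fun t : ℝ => (∫ s in (-t)..t, G s) *
        (2 * ((a ^ 2)⁻¹ : ℝ) * (t * Complex.exp (-(((a ^ 2)⁻¹ : ℝ) : ℂ) * (t : ℂ) ^ 2)))) 0 ha
    rw [mul_zero] at this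
    rw [← this, ← integral_smul]
    congr 1
    ext u
    have ha' : (a : ℂ) ≠ 0 := by exact_mod_cast ha.ne'
    have e : -(((a ^ 2)⁻¹ : ℝ) : ℂ) * ((a * u : ℝ) : ℂ) ^ 2 = -1 * (u : ℂ) ^ 2 := by
      push_cast; field_simp
    rw [e, Complex.real_smul]
    push_cast
    field_simp
  refine Tendsto.congr' h1 ?_
  have hone : (0 : ℝ) < (1 : ℂ).re := by simp
  have hL : L = ∫ u in Set.Ioi (0 : ℝ), L * (2 * ((u : ℂ) * Complex.exp (-1 * (u : ℂ) ^ 2))) := by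
    rw [integral_const_mul, integral_const_mul, integral_mul_cexp_neg_mul_sq hone]
    simp
  have hi := integrable_mul_cexp_neg_mul_sq hone
  suffices h : Tendsto (fun a : ℝ => ∫ u in Set.Ioi (0 : ℝ), (∫ s in (-(a * u))..(a * u), G s) *
        (2 * (u * Complex.exp (-1 * (u : ℂ) ^ 2)))) atTop
      (nhds (∫ u in Set.Ioi (0 : ℝ), L * (2 * ((u : ℂ) * Complex.exp (-1 * (u : ℂ) ^ 2))))) by
    rwa [← hL] at h
  refine tendsto_integral_filter_of_dominated_convergence
    (fun u : ℝ => M * ‖2 * ((u : ℂ) * Complex.exp (-1 * (u : ℂ) ^ 2))‖) ?_ ?_ ?_ ?_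
  · filter_upwards with a
    exact Continuous.aestronglyMeasurable
      ((hSm.comp (continuous_const.mul continuous_id)).mul (by fun_prop))
  · filter_upwards [eventually_gt_atTop 0] with a ha
    filter_upwards [ae_restrict_mem measurableSet_Ioi] with u hu
    rw [norm_mul]
    gcongr
    exact hM _ (mul_nonneg ha.le (le_of_lt hu))
  · exact ((hi.const_mul 2).norm.const_mul M).integrableOn
  · filter_upwards [ae_restrict_mem measurableSet_Ioi] with u hu
    refine Tendsto.mul_const _ ?_
    exact hlim.comp (tendsto_id.atTop_mul_const hu)

lemma norm_expI (t y : ℝ) : ‖Complex.exp (Complex.I * t * y)‖ = 1 := by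
  rw [Complex.norm_exp]; simp

lemma fub (f : ℝ → ℂ) (ν : Measure ℝ) [IsFiniteMeasure ν]
    (hf : Integrable f) (b : ℝ) (hb : 0 < b) :
    ∫ t : ℝ, ((∫ y : ℝ, f y * Complex.exp (Complex.I * t * y)) *
        (∫ y : ℝ, Complex.exp (Complex.I * (-t : ℝ) * y) ∂ν)) *
          Complex.exp (-(b : ℂ) * (t : ℂ) ^ 2) =
      ∫ x, (∫ y, f y * ∫ t : ℝ, Complex.exp (Complex.I * ((y - x : ℝ) : ℂ) * t) *
          Complex.exp (-(b : ℂ) * (t : ℂ) ^ 2)) ∂ν := by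
  have hbre : 0 < (b : ℂ).re := by simpa using hb
  have hw := integrable_cexp_neg_mul_sq hbre
  have h0 : Integrable (fun z : ℝ × (ℝ × ℝ) => Complex.exp (-(b : ℂ) * (z.1 : ℂ) ^ 2) *
      (f z.2.1 * 1)) (volume.prod (volume.prod ν)) :=
    hw.mul_prod (hf.mul_prod (integrable_const (1 : ℂ)))
  have h1 : Integrable (Function.uncurry fun (t : ℝ) (p : ℝ × ℝ) =>
      Complex.exp (Complex.I * t * (p.1 - p.2 : ℝ)) *
      (Complex.exp (-(b : ℂ) * (t : ℂ) ^ 2) * (f p.1 * 1))) (volume.prod (volume.prod ν)) := by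
    refine h0.bdd_mul (c := 1) (Continuous.aestronglyMeasurable (by fun_prop)) ?_
    exact Eventually.of_forall fun z => (norm_expI _ _).le
  have h2 := integral_integral_swap h1
  have h3 := h1.integral_prod_right
  refine Eq.trans ?_ (h2.trans ((integral_prod_symm _ h3).trans ?_))
  · congr 1
    ext t
    rw [← integral_prod_mul, ← integral_mul_const]
    congr 1
    ext p
    have : Complex.exp (Complex.I * t * (p.1 - p.2 : ℝ)) =
      Complex.exp (Complex.I * t * p.1) * Complex.exp (Complex.I * (-t : ℝ) * p.2) := by
      rw [← Complex.exp_add]; congr 1; push_cast; ring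
    rw [this]; ring
  · congr 1
    ext x
    congr 1
    ext y
    rw [← integral_const_mul]
    congr 1
    ext t
    simp only [Function.uncurry]
    rw [mul_right_comm Complex.I (t : ℂ)]
    ring

lemma kern (a : ℝ) (ha : 0 < a) (z : ℝ) :
    ∫ t : ℝ, Complex.exp (Complex.I * (z : ℂ) * t) *
          Complex.exp (-(((a ^ 2)⁻¹ : ℝ) : ℂ) * (t : ℂ) ^ 2) =
    ((a * √Real.pi * Real.exp (-(a ^ 2 / 4) * z ^ 2) : ℝ) : ℂ) := by
  have hb : 0 < (((a ^ 2)⁻¹ : ℝ) : ℂ).re := by rw [Complex.ofReal_re]; positivity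
  rw [fourierIntegral_gaussian hb]
  have e1 : ((Real.pi : ℂ) / (((a ^ 2)⁻¹ : ℝ) : ℂ)) ^ (1 / 2 : ℂ) = ((a * √Real.pi : ℝ) : ℂ) := by
    rw [← Complex.ofReal_div, show (1 / 2 : ℂ) = ((1 / 2 : ℝ) : ℂ) by push_cast; rfl,
      ← Complex.ofReal_cpow (by positivity), ← Real.sqrt_eq_rpow]
    congr 1
    rw [div_inv_eq_mul, mul_comm, Real.sqrt_mul (by positivity), Real.sqrt_sq ha.le]
  rw [e1, Complex.ofReal_mul (a * √Real.pi), Complex.ofReal_exp]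
  congr 2
  push_cast
  have ha' : (a : ℂ) ≠ 0 := by exact_mod_cast ha.ne'
  field_simp

lemma kern_lim (f : ℝ → ℂ) (hf : Integrable f) (x : ℝ) (hx : ContinuousAt f x) :
    Tendsto (fun a : ℝ => ∫ y, f y *
      ((a * √Real.pi * Real.exp (-(a ^ 2 / 4) * (y - x) ^ 2) : ℝ) : ℂ)) atTop
      (nhds ((2 * Real.pi : ℝ) * f x)) := by
  have h := Real.tendsto_integral_gaussian_smul' hf hx
  have hc : Tendsto (fun a : ℝ => a ^ 2 / (4 * Real.pi ^ 2)) atTop atTop :=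
    (tendsto_pow_atTop two_ne_zero).atTop_div_const (by positivity)
  have h2 := (h.comp hc).const_mul ((2 * Real.pi : ℝ) : ℂ)
  refine h2.congr' ?_
  filter_upwards [eventually_gt_atTop 0] with a ha
  simp only [Function.comp]
  rw [← integral_const_mul]
  congr 1
  ext y
  have e1 : ((Real.pi : ℂ) * ((a ^ 2 / (4 * Real.pi ^ 2) : ℝ) : ℂ)) ^
      ((Module.finrank ℝ ℝ : ℂ) / 2) = ((a / (2 * √Real.pi) : ℝ) : ℂ) := by
    rw [← Complex.ofReal_mul, show ((Module.finrank ℝ ℝ : ℂ) / 2) = ((1 / 2 : ℝ) : ℂ) by simp,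
      ← Complex.ofReal_cpow (by positivity), ← Real.sqrt_eq_rpow]
    congr 1
    rw [Real.sqrt_eq_iff_mul_self_eq (by positivity) (by positivity)]
    have := Real.mul_self_sqrt Real.pi_pos.le
    have hp := Real.pi_pos
    rw [div_mul_div_comm, show 2 * √Real.pi * (2 * √Real.pi) = 4 * (√Real.pi * √Real.pi) by ring,
      this]
    field_simp
  have e2 : Complex.exp (-(Real.pi : ℂ) ^ 2 * ((a ^ 2 / (4 * Real.pi ^ 2) : ℝ) : ℂ) *
      (‖x - y‖ : ℂ) ^ 2) = ((Real.exp (-(a ^ 2 / 4) * (y - x) ^ 2) : ℝ) : ℂ) := by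
    rw [Complex.ofReal_exp]
    congr 1
    rw [← Complex.ofReal_pow ‖x - y‖, Real.norm_eq_abs, sq_abs]
    push_cast
    have hp : (Real.pi : ℂ) ≠ 0 := by exact_mod_cast Real.pi_ne_zero
    field_simp
    ring
  rw [e1, e2, smul_eq_mul]
  have e3 : (2 * Real.pi) * (a / (2 * √Real.pi)) = a * √Real.pi := by
    have := Real.mul_self_sqrt Real.pi_pos.le
    have hp : √Real.pi ≠ 0 := (Real.sqrt_pos.2 Real.pi_pos).ne'
    field_simp
    rw [sq, this]
  rw [Complex.ofReal_mul (a * √Real.pi), ← e3]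
  push_cast
  ring

lemma kern_bdd (f : ℝ → ℂ) (C : ℝ) (hC : ∀ x, ‖f x‖ ≤ C) (a : ℝ) (ha : 0 < a) (x : ℝ) :
    ‖∫ y, f y * ((a * √Real.pi * Real.exp (-(a ^ 2 / 4) * (y - x) ^ 2) : ℝ) : ℂ)‖ ≤
      C * (2 * Real.pi) := by
  have hi : Integrable (fun y : ℝ => Real.exp (-(a ^ 2 / 4) * (y - x) ^ 2)) :=
    (integrable_exp_neg_mul_sq (b := a ^ 2 / 4) (by positivity)).comp_sub_right x
  have hI : ∫ y : ℝ, Real.exp (-(a ^ 2 / 4) * (y - x) ^ 2) = 2 * √Real.pi / a := by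
    rw [integral_sub_right_eq_self (fun y : ℝ => Real.exp (-(a ^ 2 / 4) * y ^ 2)) x,
      integral_gaussian, Real.sqrt_eq_iff_mul_self_eq (by positivity) (by positivity)]
    have := Real.mul_self_sqrt Real.pi_pos.le
    rw [div_mul_div_comm, show 2 * √Real.pi * (2 * √Real.pi) = 4 * (√Real.pi * √Real.pi) by ring,
      this]
    field_simp
  refine (norm_integral_le_of_norm_le (g := fun y =>
    C * (a * √Real.pi * Real.exp (-(a ^ 2 / 4) * (y - x) ^ 2)))
    ((hi.const_mul _).const_mul _) (Eventually.of_forall fun y => ?_)).trans ?_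
  · rw [norm_mul, Complex.norm_real, Real.norm_of_nonneg (by positivity)]
    gcongr
    exact hC y
  · rw [integral_const_mul, integral_const_mul, hI]
    have := Real.mul_self_sqrt Real.pi_pos.le
    apply le_of_eq
    congr 1
    field_simp
    rw [sq, this]

/--
Let `f : ℝ → ℂ` be integrable and bounded, and let `ν` be a finite Borel measure on `ℝ` such
that `f` is continuous `ν`-almost everywhere. Define the transforms
`f̂(t) = ∫_ℝ f(y) e^{ity} dy` and `ν̂(t) = ∫_ℝ e^{ity} dν(y)`. If the symmetric limit
`lim_{A→∞} ∫_{-A}^{A} f̂(t) ν̂(-t) dt` exists, then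
`∫_ℝ f dν = (1/(2π)) · lim_{A→∞} ∫_{-A}^{A} f̂(t) ν̂(-t) dt`.
-/
theorem stmt7 (f : ℝ → ℂ) (ν : Measure ℝ) [IsFiniteMeasure ν]
    (hf_int : Integrable f)
    (hf_bdd : ∃ C : ℝ, ∀ x : ℝ, ‖f x‖ ≤ C)
    (hf_cont : ∀ᵐ x ∂ν, ContinuousAt f x)
    (L : ℂ)
    (hlim : Tendsto (fun A : ℝ => ∫ t in (-A)..A,
        (∫ y : ℝ, f y * Complex.exp (Complex.I * t * y)) *
        (∫ y : ℝ, Complex.exp (Complex.I * (-t : ℝ) * y) ∂ν)) atTop (nhds L)) :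
    ∫ x, f x ∂ν = ((1 / (2 * Real.pi) : ℝ) : ℂ) * L := by
  obtain ⟨C, hC⟩ := hf_bdd
  have hG : Continuous (fun t : ℝ => (∫ y : ℝ, f y * Complex.exp (Complex.I * t * y)) *
        (∫ y : ℝ, Complex.exp (Complex.I * (-t : ℝ) * y) ∂ν)) := by
    refine Continuous.mul ?_ ?_
    · refine continuous_of_dominated (bound := fun y => ‖f y‖) (fun t => ?_) (fun t => ?_)
        hf_int.norm ?_
      · exact hf_int.aestronglyMeasurable.mul (Continuous.aestronglyMeasurable (by fun_prop))
      · exact Eventually.of_forall fun y => by rw [norm_mul, norm_expI, mul_one]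
      · exact Eventually.of_forall fun y => by fun_prop
    · refine continuous_of_dominated (bound := fun y => 1) (fun t => ?_) (fun t => ?_)
        (integrable_const _) ?_
      · exact Continuous.aestronglyMeasurable (by fun_prop)
      · exact Eventually.of_forall fun y => (norm_expI _ _).le
      · exact Eventually.of_forall fun y => by fun_prop
  have hGb : ∀ t : ℝ, ‖(∫ y : ℝ, f y * Complex.exp (Complex.I * t * y)) *
        (∫ y : ℝ, Complex.exp (Complex.I * (-t : ℝ) * y) ∂ν)‖ ≤
        (∫ y, ‖f y‖) * (∫ _y, (1 : ℝ) ∂ν) := by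
    intro t
    rw [norm_mul]
    refine mul_le_mul ?_ ?_ (norm_nonneg _) (integral_nonneg fun _ => norm_nonneg _)
    · exact norm_integral_le_of_norm_le hf_int.norm
        (Eventually.of_forall fun y => by rw [norm_mul, norm_expI, mul_one])
    · exact norm_integral_le_of_norm_le (integrable_const _)
        (Eventually.of_forall fun y => (norm_expI _ _).le)
  have h1 := abel_lim _ hG _ hGb L hlim
  have h2 : Tendsto (fun a : ℝ => ∫ x, (∫ y, f y *
      ((a * √Real.pi * Real.exp (-(a ^ 2 / 4) * (y - x) ^ 2) : ℝ) : ℂ)) ∂ν) atTop (nhds L) := by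
    refine h1.congr' ?_
    filter_upwards [eventually_gt_atTop 0] with a ha
    rw [fub f ν hf_int _ (by positivity)]
    simp_rw [kern a ha]
  have h3 : Tendsto (fun a : ℝ => ∫ x, (∫ y, f y *
      ((a * √Real.pi * Real.exp (-(a ^ 2 / 4) * (y - x) ^ 2) : ℝ) : ℂ)) ∂ν) atTop
      (nhds (∫ x, ((2 * Real.pi : ℝ) : ℂ) * f x ∂ν)) := by
    refine tendsto_integral_filter_of_dominated_convergence (fun _ => C * (2 * Real.pi)) ?_ ?_
      (integrable_const _) ?_
    · filter_upwards with a
      have : AEStronglyMeasurable (fun p : ℝ × ℝ => f p.2 *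
          ((a * √Real.pi * Real.exp (-(a ^ 2 / 4) * (p.2 - p.1) ^ 2) : ℝ) : ℂ))
          (ν.prod volume) :=
        hf_int.aestronglyMeasurable.comp_snd.mul (Continuous.aestronglyMeasurable (by fun_prop))
      exact this.integral_prod_right'
    · filter_upwards [eventually_gt_atTop 0] with a ha
      exact Eventually.of_forall fun x => kern_bdd f C hC a ha x
    · filter_upwards [hf_cont] with x hx using kern_lim f hf_int x hx
  have h4 := tendsto_nhds_unique h2 h3
  rw [h4, integral_const_mul, ← mul_assoc, ← Complex.ofReal_mul]
  have : 1 / (2 * Real.pi) * (2 * Real.pi) = 1 := by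
    have := Real.pi_pos
    field_simp
  rw [this]
  simp
end

section
/- Let f : (0,∞) → ℂ be locally integrable and let μ be a Borel measure on (0,∞). Let σ ∈ ℝ be such that ∫₀^∞ x^{σ-1}|f(x)| dx < ∞ and ∫₀^∞ x^{-σ} dμ(x) < ∞, so the Mellin transforms Mf(σ+it) = ∫₀^∞ x^{σ+it-1} f(x) dx and Mμ(1-σ-it) = ∫₀^∞ x^{-σ-it} dμ(x) are defined for all t ∈ ℝ. Suppose that x^σ f(x) is bounded on (0,∞), that f is continuous μ-almost everywhere, and that the symmetric limit lim_{A→∞} ∫_{-A}^{A} Mf(σ+it) · Mμ(1-σ-it) dt exists. Then ∫₀^∞ f(x) dμ(x) = (1/(2π)) · lim_{A→∞} ∫_{-A}^{A} Mf(σ+it) · Mμ(1-σ-it) dt. -/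
open MeasureTheory Filter

lemma abel_aux (Φ : ℝ → ℂ) (hc : Continuous Φ) (B : ℝ) (hB : ∀ t, ‖Φ t‖ ≤ B) (L : ℂ)
    (hlim : Tendsto (fun A : ℝ => ∫ t in (-A)..A, Φ t) atTop (nhds L)) :
    Tendsto (fun r : ℝ => ∫ t : ℝ, Complex.exp (-((r⁻¹ ^ 2 : ℝ) : ℂ) * (t : ℂ) ^ 2) * Φ t)
      atTop (nhds L) := by
  set F : ℝ → ℂ := fun A => ∫ t in (-A)..A, Φ t with hF
  have hint : ∀ a b, IntervalIntegrable Φ volume a b := fun a b => hc.intervalIntegrable a b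
  have hFd : ∀ x, HasDerivAt F (Φ x + Φ (-x)) x := by
    intro x
    have h1 : HasDerivAt (fun A : ℝ => ∫ t in (0:ℝ)..A, Φ t) (Φ x) x :=
      intervalIntegral.integral_hasDerivAt_right (hint _ _)
        (hc.stronglyMeasurableAtFilter _ _) hc.continuousAt
    have h2 : HasDerivAt (fun A : ℝ => ∫ t in (0:ℝ)..A, Φ t) (Φ (-x)) (-x) :=
      intervalIntegral.integral_hasDerivAt_right (hint _ _)
        (hc.stronglyMeasurableAtFilter _ _) hc.continuousAt
    have h3 := h1.sub (h2.scomp x (hasDerivAt_neg x))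
    have : F = (fun A : ℝ => ∫ t in (0:ℝ)..A, Φ t) -
        (fun A : ℝ => ∫ t in (0:ℝ)..A, Φ t) ∘ Neg.neg := by
      ext A
      simp only [hF, Pi.sub_apply, Function.comp]
      rw [intervalIntegral.integral_interval_sub_left (hint _ _) (hint _ _)]
    rw [this]
    refine h3.congr_deriv ?_
    simp
  have hFc : Continuous F := continuous_iff_continuousAt.2 fun x => (hFd x).continuousAt
  have hFodd : ∀ x, F (-x) = - F x := by
    intro x
    simp only [hF, neg_neg]
    exact intervalIntegral.integral_symm _ _
  have hFbdd : ∃ K, ∀ x, ‖F x‖ ≤ K := by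
    have h1 : ∀ᶠ x in atTop, ‖F x‖ < ‖L‖ + 1 := hlim.norm.eventually_lt_const (by linarith)
    obtain ⟨a, ha⟩ := eventually_atTop.1 h1
    obtain ⟨K, hK⟩ := (isCompact_Icc (a := (0:ℝ)) (b := a)).exists_bound_of_continuousOn
      hFc.continuousOn
    have h2 : ∀ x, 0 ≤ x → ‖F x‖ ≤ max K (‖L‖ + 1) := by
      intro x hx
      rcases le_total a x with h | h
      · exact (ha x h).le.trans (le_max_right _ _)
      · exact (hK x ⟨hx, h⟩).trans (le_max_left _ _)
    refine ⟨max K (‖L‖ + 1), fun x => ?_⟩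
    rcases le_total 0 x with h | h
    · exact h2 x h
    · have := h2 (-x) (by linarith)
      rwa [hFodd, norm_neg] at this
  obtain ⟨K, hK⟩ := hFbdd
  -- integration by parts
  have key : ∀ r : ℝ, 0 < r →
      ∫ t : ℝ, Complex.exp (-((r⁻¹ ^ 2 : ℝ) : ℂ) * (t : ℂ) ^ 2) * Φ t =
      ∫ s : ℝ, F (r * s) * ((s : ℂ) * Complex.exp (-(1:ℂ) * (s : ℂ) ^ 2)) := by
    intro r hr
    set b : ℝ := r⁻¹ ^ 2 with hb
    have hb0 : 0 < b := by positivity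
    have hbre : 0 < ((b : ℂ)).re := by simpa using hb0
    have i0 := integrable_cexp_neg_mul_sq hbre
    have i1 := integrable_mul_cexp_neg_mul_sq hbre
    have iΦ : Integrable (fun t : ℝ => Complex.exp (-(b : ℂ) * (t : ℂ) ^ 2) * Φ t) :=
      i0.mul_bdd (c := B) hc.aestronglyMeasurable (ae_of_all _ hB)
    have iΦ' : Integrable (fun t : ℝ => Complex.exp (-(b : ℂ) * (t : ℂ) ^ 2) * Φ (-t)) :=
      i0.mul_bdd (c := B) (hc.comp continuous_neg).aestronglyMeasurable
        (ae_of_all _ fun t => hB _)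
    have iF : Integrable (fun t : ℝ => Complex.exp (-(b : ℂ) * (t : ℂ) ^ 2) * F t) :=
      i0.mul_bdd (c := K) hFc.aestronglyMeasurable (ae_of_all _ hK)
    have iF' : Integrable (fun t : ℝ => ((t : ℂ) * Complex.exp (-(b : ℂ) * (t : ℂ) ^ 2)) * F t) :=
      i1.mul_bdd (c := K) hFc.aestronglyMeasurable (ae_of_all _ hK)
    have hv : ∀ x : ℝ, HasDerivAt (fun t : ℝ => Complex.exp (-(b : ℂ) * (t : ℂ) ^ 2))
        (-2 * b * ((x : ℂ) * Complex.exp (-(b : ℂ) * (x : ℂ) ^ 2))) x := by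
      intro x
      have h1 : HasDerivAt (fun z : ℂ => Complex.exp (-(b : ℂ) * z ^ 2))
          (Complex.exp (-(b : ℂ) * (x:ℂ) ^ 2) * (-(b : ℂ) * (((2:ℕ):ℂ) * (x:ℂ) ^ (2-1)))) (x:ℂ) :=
        ((hasDerivAt_pow 2 (x:ℂ)).const_mul (-(b : ℂ))).cexp
      convert h1.comp_ofReal using 1
      push_cast
      ring
    have P := integral_mul_deriv_eq_deriv_mul_of_integrable
      (u := F) (u' := fun x => Φ x + Φ (-x))
      (v := fun t : ℝ => Complex.exp (-(b : ℂ) * (t : ℂ) ^ 2))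
      (v' := fun x : ℝ => -2 * b * ((x : ℂ) * Complex.exp (-(b : ℂ) * (x : ℂ) ^ 2)))
      (fun x _ => hFd x) (fun x _ => hv x)
      ((iF'.const_mul (-2 * b)).congr (ae_of_all _ fun t => by simp only [Pi.mul_apply]; ring))
      ((iΦ.add iΦ').congr (ae_of_all _ fun t => by simp only [Pi.mul_apply, Pi.add_apply]; ring))
      (iF.congr (ae_of_all _ fun t => by simp only [Pi.mul_apply]; ring))
    have e1 : ∫ x : ℝ, (Φ x + Φ (-x)) * Complex.exp (-(b : ℂ) * (x : ℂ) ^ 2) =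
        2 * ∫ t : ℝ, Complex.exp (-(b : ℂ) * (t : ℂ) ^ 2) * Φ t := by
      have : ∫ t : ℝ, Complex.exp (-(b : ℂ) * (t : ℂ) ^ 2) * Φ (-t) =
          ∫ t : ℝ, Complex.exp (-(b : ℂ) * (t : ℂ) ^ 2) * Φ t := by
        rw [← integral_neg_eq_self (fun t : ℝ => Complex.exp (-(b : ℂ) * (t : ℂ) ^ 2) * Φ t)]
        simp
      rw [two_mul]
      nth_rw 2 [← this]
      rw [← integral_add iΦ iΦ']
      congr 1; ext t; ring
    have e2 : ∫ x : ℝ, F x * (-2 * b * ((x : ℂ) * Complex.exp (-(b : ℂ) * (x : ℂ) ^ 2))) =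
        -2 * b * ∫ x : ℝ, F x * ((x : ℂ) * Complex.exp (-(b : ℂ) * (x : ℂ) ^ 2)) := by
      rw [← integral_const_mul]
      congr 1; ext t; ring
    have e3 : ∫ s : ℝ, F (r * s) * ((s : ℂ) * Complex.exp (-(1:ℂ) * (s : ℂ) ^ 2)) =
        b * ∫ x : ℝ, F x * ((x : ℂ) * Complex.exp (-(b : ℂ) * (x : ℂ) ^ 2)) := by
      have h := Measure.integral_comp_mul_left
        (fun x : ℝ => F x * (((r⁻¹ * x : ℝ) : ℂ) * Complex.exp (-(b : ℂ) * (x : ℂ) ^ 2))) r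
      have hrc : (r:ℂ) ≠ 0 := by exact_mod_cast hr.ne'
      have h4 : ∀ s : ℝ, F (r * s) * ((s : ℂ) * Complex.exp (-(1:ℂ) * (s : ℂ) ^ 2)) =
          F (r * s) * (((r⁻¹ * (r * s) : ℝ) : ℂ) *
            Complex.exp (-(b : ℂ) * ((r * s : ℝ) : ℂ) ^ 2)) := by
        intro s
        rw [inv_mul_cancel_left₀ hr.ne']
        congr 3
        rw [hb]; push_cast; field_simp
      simp_rw [h4]
      rw [h, abs_of_pos (by positivity), ← integral_smul, ← integral_const_mul]
      congr 1; ext t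
      rw [hb, Complex.real_smul]; push_cast; ring
    rw [e1, e2] at P
    rw [e3]
    linear_combination (1/2 : ℂ) * P
  have i1 := integrable_mul_cexp_neg_mul_sq (b := 1) (by simp)
  have lim2 : Tendsto (fun r : ℝ => ∫ s : ℝ, F (r * s) * ((s : ℂ) *
      Complex.exp (-(1:ℂ) * (s : ℂ) ^ 2))) atTop
      (nhds (∫ s : ℝ, L * ((|s| : ℝ) * Complex.exp (-(1:ℂ) * ((|s| : ℝ) : ℂ) ^ 2)))) := by
    apply tendsto_integral_filter_of_dominated_convergence
      (fun s : ℝ => K * ‖(s : ℂ) * Complex.exp (-(1:ℂ) * (s : ℂ) ^ 2)‖)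
    · refine Eventually.of_forall fun r => ?_
      exact (hFc.comp (continuous_const.mul continuous_id)).aestronglyMeasurable.mul
        i1.aestronglyMeasurable
    · refine Eventually.of_forall fun r => ae_of_all _ fun s => ?_
      rw [norm_mul]
      exact mul_le_mul_of_nonneg_right (hK _) (norm_nonneg _)
    · exact i1.norm.const_mul K
    · refine ae_of_all _ fun s => ?_
      have hsq : (((|s| : ℝ) : ℂ)) ^ 2 = (s:ℂ)^2 := by
        rw [← Complex.ofReal_pow, sq_abs, Complex.ofReal_pow]
      rw [hsq]
      rcases lt_trichotomy s 0 with h | h | h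
      · have : Tendsto (fun r : ℝ => F (r * s)) atTop (nhds (-L)) := by
          have h5 : Tendsto (fun r : ℝ => r * (-s)) atTop atTop :=
            tendsto_id.atTop_mul_const (by linarith)
          have h6 := (hlim.comp h5).neg
          refine h6.congr fun r => ?_
          simp only [Function.comp]
          rw [mul_neg, hFodd, neg_neg]
        convert this.mul_const _ using 2
        rw [abs_of_neg h]; push_cast; ring
      · simp [h]
      · have h5 : Tendsto (fun r : ℝ => r * s) atTop atTop :=
            tendsto_id.atTop_mul_const h
        rw [abs_of_pos h]
        exact (hlim.comp h5).mul_const _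
  have e4 : (∫ s : ℝ, L * ((|s| : ℝ) * Complex.exp (-(1:ℂ) * ((|s| : ℝ) : ℂ) ^ 2))) = L := by
    rw [integral_const_mul]
    have h1 := integral_mul_cexp_neg_mul_sq (b := 1) (by simp)
    have h2 := integral_comp_abs (f := fun s : ℝ => s * Real.exp (-1 * s ^ 2))
    have h3 : ((∫ x in Set.Ioi (0:ℝ), x * Real.exp (-1 * x ^ 2) : ℝ) : ℂ) = (2 * 1)⁻¹ := by
      rw [← h1, ← integral_complex_ofReal]
      congr 1; ext x; push_cast; rfl
    have h4 : ∫ s : ℝ, ((|s| : ℝ) : ℂ) * Complex.exp (-(1:ℂ) * ((|s| : ℝ) : ℂ) ^ 2) =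
        ((∫ x : ℝ, |x| * Real.exp (-1 * |x| ^ 2) : ℝ) : ℂ) := by
      rw [← integral_complex_ofReal]
      congr 1; ext x; push_cast; rfl
    rw [h4, h2, Complex.ofReal_mul, h3]
    simp
  rw [e4] at lim2
  refine lim2.congr' ?_
  filter_upwards [eventually_gt_atTop 0] with r hr
  exact (key r hr).symm

lemma kernel_aux (c : ℝ) (hc : 0 < c) (v w : ℝ) :
    ∫ t : ℝ, Complex.exp (-((((2 * Real.pi * √c)⁻¹ ^ 2 : ℝ)) : ℂ) * (t : ℂ) ^ 2) *
      Complex.exp (Complex.I * t * ((w - v : ℝ) : ℂ)) =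
    2 * Real.pi * ((Real.pi * c : ℂ) ^ ((1 : ℂ) / 2) *
      Complex.exp (-Real.pi ^ 2 * c * ‖v - w‖ ^ 2)) := by
  have hpi := Real.pi_pos
  set b : ℝ := (2 * Real.pi * √c)⁻¹ ^ 2 with hb
  have hb' : b = 1 / (4 * Real.pi ^ 2 * c) := by
    rw [hb, inv_pow, mul_pow, Real.sq_sqrt hc.le]; ring
  have hb0 : 0 < b := by positivity
  have h := fourierIntegral_gaussian (b := (b : ℂ)) (by simpa using hb0) ((w - v : ℝ) : ℂ)
  have h2 : (Real.pi / b : ℂ) ^ ((1 : ℂ) / 2) =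
      2 * Real.pi * (Real.pi * c : ℂ) ^ ((1 : ℂ) / 2) := by
    have e : (Real.pi / b : ℂ) = (((2 * Real.pi) ^ 2 * (Real.pi * c) : ℝ) : ℂ) := by
      rw [hb']; push_cast; field_simp; ring
    have e2 : (Real.pi * c : ℂ) = ((Real.pi * c : ℝ) : ℂ) := by push_cast; rfl
    have e3 : ((1:ℂ)/2) = ((1/2 : ℝ) : ℂ) := by push_cast; rfl
    rw [e, e2, e3, ← Complex.ofReal_cpow (by positivity), ← Complex.ofReal_cpow (by positivity),
      ← Real.sqrt_eq_rpow, ← Real.sqrt_eq_rpow, Real.sqrt_mul (by positivity),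
      Real.sqrt_sq (by positivity)]
    push_cast; ring
  rw [← mul_assoc, ← h2]
  have h3 : (-Real.pi ^ 2 * c * ‖v - w‖ ^ 2 : ℂ) = -((w - v : ℝ) : ℂ) ^ 2 / (4 * (b : ℂ)) := by
    rw [← Complex.ofReal_pow ‖v - w‖, Real.norm_eq_abs, sq_abs, hb']
    push_cast
    have : (Real.pi : ℂ) ≠ 0 := by exact_mod_cast hpi.ne'
    have : (c : ℂ) ≠ 0 := by exact_mod_cast hc.ne'
    field_simp; ring
  rw [h3, ← h]
  congr 1; ext t
  rw [mul_comm, mul_right_comm Complex.I]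

lemma kernel_norm (c : ℝ) (hc : 0 < c) (v : ℝ) :
    Integrable (fun w : ℝ => (Real.pi * c : ℂ) ^ ((1 : ℂ) / 2) *
      Complex.exp (-Real.pi ^ 2 * c * ‖v - w‖ ^ 2)) ∧
    ∫ w : ℝ, ‖(Real.pi * c : ℂ) ^ ((1 : ℂ) / 2) *
      Complex.exp (-Real.pi ^ 2 * c * ‖v - w‖ ^ 2)‖ = 1 := by
  have hpi := Real.pi_pos
  have e : ∀ w : ℝ, (Real.pi * c : ℂ) ^ ((1 : ℂ) / 2) *
      Complex.exp (-Real.pi ^ 2 * c * ‖v - w‖ ^ 2) =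
      ((√(Real.pi * c) * Real.exp (-(Real.pi ^ 2 * c) * (v - w) ^ 2) : ℝ) : ℂ) := by
    intro w
    have e2 : (Real.pi * c : ℂ) = ((Real.pi * c : ℝ) : ℂ) := by push_cast; rfl
    have e3 : ((1:ℂ)/2) = ((1/2 : ℝ) : ℂ) := by push_cast; rfl
    rw [Complex.ofReal_mul, Real.sqrt_eq_rpow, Complex.ofReal_cpow (by positivity), ← e2, ← e3,
      ← Complex.ofReal_pow ‖v - w‖, Real.norm_eq_abs, sq_abs]
    push_cast
    ring_nf
  have i := ((integrable_exp_neg_mul_sq (b := Real.pi ^ 2 * c) (by positivity)).const_mul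
    (√(Real.pi * c))).comp_sub_left v
  constructor
  · simp_rw [e]
    exact i.ofReal
  · simp_rw [e, Complex.norm_real]
    have : ∀ w : ℝ, ‖√(Real.pi * c) * Real.exp (-(Real.pi ^ 2 * c) * (v - w) ^ 2)‖ =
        √(Real.pi * c) * Real.exp (-(Real.pi ^ 2 * c) * (v - w) ^ 2) :=
      fun w => Real.norm_of_nonneg (by positivity)
    simp_rw [this]
    rw [integral_const_mul, integral_sub_left_eq_self
      (fun x : ℝ => Real.exp (-(Real.pi ^ 2 * c) * x ^ 2)), integral_gaussian,
      ← Real.sqrt_mul (by positivity)]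
    rw [Real.sqrt_eq_one]
    field_simp

lemma norm_cexp_aux (t u : ℝ) : ‖Complex.exp (Complex.I * t * u)‖ = 1 := by
  have : Complex.I * t * u = ((t * u : ℝ) : ℂ) * Complex.I := by push_cast; ring
  rw [this, Complex.norm_exp_ofReal_mul_I]

lemma core_aux (g : ℝ → ℂ) (hg : Integrable g) (C : ℝ) (hC : ∀ u, ‖g u‖ ≤ C)
    (ν : Measure ℝ) [IsFiniteMeasure ν] (φ : ℝ → ℝ) (hφ : Measurable φ)
    (hcont : ∀ᵐ x ∂ν, ContinuousAt g (φ x)) (L : ℂ)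
    (hlim : Tendsto (fun A : ℝ => ∫ t in (-A)..A,
      (∫ u : ℝ, Complex.exp (Complex.I * t * u) * g u) *
      (∫ x : ℝ, Complex.exp (Complex.I * t * ((-φ x : ℝ) : ℂ)) ∂ν)) atTop (nhds L)) :
    ∫ x, g (φ x) ∂ν = ((1 / (2 * Real.pi) : ℝ) : ℂ) * L := by
  have hpi := Real.pi_pos
  set G : ℝ → ℂ := fun t => ∫ u : ℝ, Complex.exp (Complex.I * t * u) * g u with hG
  set N : ℝ → ℂ := fun t => ∫ x : ℝ, Complex.exp (Complex.I * t * ((-φ x : ℝ) : ℂ)) ∂ν with hN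
  have hGc : Continuous G := by
    apply continuous_of_dominated (bound := fun u => ‖g u‖)
    · intro t
      exact (by fun_prop : Continuous fun u : ℝ => Complex.exp (Complex.I * t * u)).aestronglyMeasurable.mul hg.1
    · intro t
      exact ae_of_all _ fun u => by rw [norm_mul, norm_cexp_aux, one_mul]
    · exact hg.norm
    · exact ae_of_all _ fun u => by fun_prop
  have hNc : Continuous N := by
    apply continuous_of_dominated (bound := fun u => (1:ℝ))
    · intro t
      exact (by fun_prop : Measurable fun x : ℝ => Complex.exp (Complex.I * t * ((-φ x : ℝ) : ℂ))).aestronglyMeasurable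
    · intro t
      exact ae_of_all _ fun u => by rw [norm_cexp_aux]
    · exact integrable_const _
    · exact ae_of_all _ fun u => by fun_prop
  have hGb : ∀ t, ‖G t‖ ≤ ∫ u, ‖g u‖ := by
    intro t
    refine (norm_integral_le_integral_norm _).trans (le_of_eq ?_)
    congr 1; ext u; rw [norm_mul, norm_cexp_aux, one_mul]
  have hNb : ∀ t, ‖N t‖ ≤ ν.real Set.univ := by
    intro t
    refine (norm_integral_le_integral_norm _).trans (le_of_eq ?_)
    simp only [norm_cexp_aux]
    simp
  have hab := abel_aux (fun t => G t * N t) (hGc.mul hNc) ((∫ u, ‖g u‖) * ν.real Set.univ)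
    (fun t => by
      rw [norm_mul]
      exact mul_le_mul (hGb t) (hNb t) (norm_nonneg _) ((norm_nonneg _).trans (hGb t))) L hlim
  have hr : Tendsto (fun c : ℝ => 2 * Real.pi * √c) atTop atTop :=
    Real.tendsto_sqrt_atTop.const_mul_atTop (by positivity)
  have hab2 := hab.comp hr
  -- the smoothed function
  set S : ℝ → ℝ → ℂ := fun c v => ∫ w : ℝ, ((Real.pi * c : ℂ) ^ ((1 : ℂ) / 2) *
      Complex.exp (-Real.pi ^ 2 * c * ‖v - w‖ ^ 2)) * g w with hS
  have fub : ∀ c : ℝ, 0 < c →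
      ∫ t : ℝ, Complex.exp (-((((2 * Real.pi * √c)⁻¹ ^ 2 : ℝ)) : ℂ) * (t : ℂ) ^ 2) * (G t * N t)
      = 2 * Real.pi * ∫ x, S c (φ x) ∂ν := by
    intro c hc
    set b : ℝ := (2 * Real.pi * √c)⁻¹ ^ 2 with hb
    have hb0 : 0 < b := by positivity
    have i0 := integrable_cexp_neg_mul_sq (b := (b:ℂ)) (by simpa using hb0)
    have iG : Integrable (fun t : ℝ => Complex.exp (-(b:ℂ) * (t : ℂ) ^ 2) * G t) :=
      i0.mul_bdd hGc.aestronglyMeasurable (ae_of_all _ hGb)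
    have sw1 : ∀ v : ℝ, ∫ t : ℝ, Complex.exp (-(b:ℂ) * (t : ℂ) ^ 2) * G t *
        Complex.exp (Complex.I * t * ((-v : ℝ) : ℂ)) = 2 * Real.pi * S c v := by
      intro v
      have e1 : ∀ t : ℝ, Complex.exp (-(b:ℂ) * (t : ℂ) ^ 2) * G t *
        Complex.exp (Complex.I * t * ((-v : ℝ) : ℂ)) = ∫ w : ℝ,
          (Complex.exp (-(b:ℂ) * (t : ℂ) ^ 2) * g w) *
            Complex.exp (Complex.I * t * ((w - v : ℝ) : ℂ)) := by
        intro t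
        rw [mul_right_comm, hG]
        simp only
        rw [← integral_const_mul]
        congr 1; ext w
        have : Complex.exp (Complex.I * t * ((w - v : ℝ) : ℂ)) =
          Complex.exp (Complex.I * t * w) * Complex.exp (Complex.I * t * ((-v : ℝ) : ℂ)) := by
          rw [← Complex.exp_add]; congr 1; push_cast; ring
        rw [this]; ring
      simp_rw [e1]
      rw [integral_integral_swap]
      · rw [hS]
        simp only
        rw [← integral_const_mul]
        congr 1; ext w
        rw [← mul_assoc, ← kernel_aux c hc v w, ← integral_mul_const]
        congr 1; ext t
        ring
      · refine Integrable.mul_bdd (c := 1) (i0.mul_prod hg) ?_ ?_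
        · exact (by fun_prop : Continuous fun p : ℝ × ℝ =>
            Complex.exp (Complex.I * p.1 * ((p.2 - v : ℝ) : ℂ))).aestronglyMeasurable
        · exact ae_of_all _ fun p => (norm_cexp_aux _ _).le
    have e2 : ∀ t : ℝ, Complex.exp (-(b:ℂ) * (t : ℂ) ^ 2) * (G t * N t) =
        ∫ x, Complex.exp (-(b:ℂ) * (t : ℂ) ^ 2) * G t *
          Complex.exp (Complex.I * t * ((-φ x : ℝ) : ℂ)) ∂ν := by
      intro t
      rw [integral_const_mul, mul_assoc]
    simp_rw [e2]
    rw [integral_integral_swap]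
    · simp_rw [sw1]
      rw [integral_const_mul]
    · refine Integrable.mul_bdd (c := 1)
        (f := fun p : ℝ × ℝ => Complex.exp (-(b:ℂ) * (p.1 : ℂ) ^ 2) * G p.1) ?_ ?_ ?_
      · exact iG.comp_fst ν
      · exact (by fun_prop : Measurable fun p : ℝ × ℝ =>
            Complex.exp (Complex.I * p.1 * ((-φ p.2 : ℝ) : ℂ))).aestronglyMeasurable
      · exact ae_of_all _ fun p => (norm_cexp_aux _ _).le
  have dct : Tendsto (fun c : ℝ => ∫ x, S c (φ x) ∂ν) atTop (nhds (∫ x, g (φ x) ∂ν)) := by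
    apply tendsto_integral_filter_of_dominated_convergence (fun _ => C)
    · refine Eventually.of_forall fun c => ?_
      have : StronglyMeasurable (S c) := by
        obtain ⟨g', hg', hgg'⟩ := hg.1
        have : S c = fun v => ∫ w : ℝ, ((Real.pi * c : ℂ) ^ ((1 : ℂ) / 2) *
            Complex.exp (-Real.pi ^ 2 * c * ‖v - w‖ ^ 2)) * g' w := by
          ext v
          apply integral_congr_ae
          filter_upwards [hgg'] with w hw
          rw [hw]
        rw [this]
        apply StronglyMeasurable.integral_prod_right
          (f := fun v w : ℝ => ((Real.pi * c : ℂ) ^ ((1 : ℂ) / 2) *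
            Complex.exp (-Real.pi ^ 2 * c * ‖v - w‖ ^ 2)) * g' w)
        refine StronglyMeasurable.mul ?_ (hg'.comp_measurable measurable_snd)
        exact (by fun_prop : Continuous fun p : ℝ × ℝ => ((Real.pi * c : ℂ) ^ ((1 : ℂ) / 2) *
            Complex.exp (-Real.pi ^ 2 * c * ‖p.1 - p.2‖ ^ 2))).stronglyMeasurable
      exact (this.comp_measurable hφ).aestronglyMeasurable
    · filter_upwards [eventually_gt_atTop 0] with c hc
      refine ae_of_all _ fun x => ?_
      obtain ⟨h1, h2⟩ := kernel_norm c hc (φ x)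
      calc ‖S c (φ x)‖ ≤ ∫ w : ℝ, ‖(Real.pi * c : ℂ) ^ ((1 : ℂ) / 2) *
            Complex.exp (-Real.pi ^ 2 * c * ‖φ x - w‖ ^ 2)‖ * C := by
            refine norm_integral_le_of_norm_le (h1.norm.mul_const C) (ae_of_all _ fun w => ?_)
            rw [norm_mul]
            exact mul_le_mul_of_nonneg_left (hC w) (norm_nonneg _)
        _ = C := by rw [integral_mul_const, h2, one_mul]
    · exact integrable_const _
    · filter_upwards [hcont] with x hx
      have := Real.tendsto_integral_gaussian_smul' hg hx
      simpa [hS] using this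
  have fin := tendsto_nhds_unique (hab2.congr' (by
    filter_upwards [eventually_gt_atTop 0] with c hc
    exact fub c hc)) (dct.const_mul (2 * Real.pi : ℂ))
  rw [fin]
  push_cast
  have : (Real.pi : ℂ) ≠ 0 := by exact_mod_cast hpi.ne'
  field_simp


/--
Let `f : (0,∞) → ℂ` be locally integrable and let `μ` be a Borel measure on `(0,∞)`.
Let `σ ∈ ℝ` be such that `∫₀^∞ x^{σ-1}|f(x)| dx < ∞` and `∫₀^∞ x^{-σ} dμ(x) < ∞`, so the
Mellin transforms `Mf(σ+it) = ∫₀^∞ x^{σ+it-1} f(x) dx` and `Mμ(1-σ-it) = ∫₀^∞ x^{-σ-it} dμ(x)`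
are defined for all `t ∈ ℝ`. Suppose that `x^σ f(x)` is bounded on `(0,∞)`, that `f` is
continuous `μ`-almost everywhere, and that the symmetric limit
`lim_{A→∞} ∫_{-A}^{A} Mf(σ+it) · Mμ(1-σ-it) dt` exists. Then
`∫₀^∞ f(x) dμ(x) = (1/(2π)) · lim_{A→∞} ∫_{-A}^{A} Mf(σ+it) · Mμ(1-σ-it) dt`.
-/
theorem stmt8 (f : ℝ → ℂ) (μ : Measure ℝ) (σ : ℝ)
    (hμsupp : μ (Set.Iic (0:ℝ)) = 0)
    (hf_loc : LocallyIntegrableOn f (Set.Ioi 0))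
    (hf_int : IntegrableOn (fun x : ℝ => x ^ (σ - 1) * ‖f x‖) (Set.Ioi 0))
    (hμ_int : IntegrableOn (fun x : ℝ => x ^ (-σ)) (Set.Ioi 0) μ)
    (hf_bdd : ∃ C : ℝ, ∀ x ∈ Set.Ioi (0:ℝ), x ^ σ * ‖f x‖ ≤ C)
    (hf_cont : ∀ᵐ x ∂μ, ContinuousWithinAt f (Set.Ioi 0) x)
    (L : ℂ)
    (hlim : Tendsto (fun A : ℝ => ∫ t in (-A)..A,
        (∫ x in Set.Ioi (0:ℝ), (x : ℂ) ^ ((σ : ℂ) + (t : ℂ) * Complex.I - 1) * f x) *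
        (∫ x in Set.Ioi (0:ℝ), (x : ℂ) ^ (-(σ : ℂ) - (t : ℂ) * Complex.I) ∂μ))
      atTop (nhds L)) :
    ∫ x in Set.Ioi (0:ℝ), f x ∂μ = ((1 / (2 * Real.pi) : ℝ) : ℂ) * L := by
  obtain ⟨C, hC⟩ := hf_bdd
  set g : ℝ → ℂ := fun u => ((Real.exp u ^ σ : ℝ) : ℂ) * f (Real.exp u) with hg
  have him : Real.exp '' Set.univ = Set.Ioi 0 := by rw [Set.image_univ, Real.range_exp]
  have hder : ∀ x ∈ (Set.univ : Set ℝ), HasDerivWithinAt Real.exp (Real.exp x) Set.univ x :=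
    fun x _ => (Real.hasDerivAt_exp x).hasDerivWithinAt
  have hf_m : AEStronglyMeasurable f (volume.restrict (Set.Ioi 0)) := hf_loc.aestronglyMeasurable
  have hf_i : IntegrableOn (fun x : ℝ => ((x ^ (σ - 1) : ℝ) : ℂ) * f x) (Set.Ioi 0) := by
    refine Integrable.mono' hf_int ?_ ?_
    · refine AEStronglyMeasurable.mul ?_ hf_m
      exact (by fun_prop : Measurable fun x : ℝ => ((x ^ (σ - 1) : ℝ) : ℂ)).aestronglyMeasurable
    · filter_upwards [ae_restrict_mem measurableSet_Ioi] with x hx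
      rw [norm_mul, Complex.norm_real, Real.norm_of_nonneg (Real.rpow_nonneg (le_of_lt hx) _)]
  have hgi : Integrable g := by
    rw [← him, integrableOn_image_iff_integrableOn_abs_deriv_smul MeasurableSet.univ hder
      Real.exp_injective.injOn, integrableOn_univ] at hf_i
    refine hf_i.congr (ae_of_all _ fun u => ?_)
    simp only [hg]
    rw [abs_of_pos (Real.exp_pos u), Complex.real_smul, ← mul_assoc, ← Complex.ofReal_mul,
      Real.rpow_sub_one (Real.exp_pos u).ne', mul_div_cancel₀ _ (Real.exp_pos u).ne']
  have hgb : ∀ u, ‖g u‖ ≤ C := by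
    intro u
    have := hC (Real.exp u) (Real.exp_pos u)
    rwa [hg, norm_mul, Complex.norm_real, Real.norm_of_nonneg (by positivity)]
  set d : ℝ → NNReal := fun x => Real.toNNReal (x ^ (-σ)) with hd
  have hdm : Measurable d := by fun_prop
  set ν : Measure ℝ := (μ.restrict (Set.Ioi 0)).withDensity (fun x => (d x : ENNReal)) with hν
  have hνfin : IsFiniteMeasure ν :=
    isFiniteMeasure_withDensity_ofReal hμ_int.2
  have hνint : ∀ h : ℝ → ℂ, ∫ x, h x ∂ν =
      ∫ x in Set.Ioi (0:ℝ), ((x ^ (-σ) : ℝ) : ℂ) * h x ∂μ := by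
    intro h
    rw [hν, integral_withDensity_eq_integral_smul hdm]
    refine setIntegral_congr_fun measurableSet_Ioi fun x hx => ?_
    simp only [hd, NNReal.smul_def, Real.coe_toNNReal _ (Real.rpow_nonneg (le_of_lt hx) _),
      Complex.real_smul]
  have hcont : ∀ᵐ x ∂ν, ContinuousAt g (Real.log x) := by
    refine (withDensity_absolutelyContinuous _ _).ae_le ?_
    filter_upwards [ae_restrict_mem measurableSet_Ioi, ae_restrict_of_ae hf_cont] with x hx hfx
    have hx0 : (0:ℝ) < x := hx
    have h1 : ContinuousAt f (Real.exp (Real.log x)) := by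
      rw [Real.exp_log hx0]
      exact hfx.continuousAt (Ioi_mem_nhds hx0)
    refine ContinuousAt.mul ?_ (h1.comp Real.continuous_exp.continuousAt)
    refine Complex.continuous_ofReal.continuousAt.comp ?_
    exact Real.continuous_exp.continuousAt.rpow_const (Or.inl (Real.exp_pos _).ne')
  have eF : ∀ t : ℝ, ∫ x in Set.Ioi (0:ℝ),
      (x : ℂ) ^ ((σ : ℂ) + (t : ℂ) * Complex.I - 1) * f x =
      ∫ u : ℝ, Complex.exp (Complex.I * t * u) * g u := by
    intro t
    rw [← him, integral_image_eq_integral_abs_deriv_smul MeasurableSet.univ hder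
      Real.exp_injective.injOn, setIntegral_univ]
    congr 1; ext u
    simp only [hg]
    rw [abs_of_pos (Real.exp_pos u), Complex.real_smul, ← mul_assoc, ← mul_assoc]
    congr 1
    rw [← Real.exp_mul, Complex.ofReal_exp, Complex.ofReal_exp,
      Complex.cpow_def_of_ne_zero (Complex.exp_ne_zero _), ← Complex.ofReal_exp,
      ← Complex.ofReal_log (Real.exp_pos u).le, Real.log_exp, Complex.ofReal_exp,
      ← Complex.exp_add, ← Complex.exp_add]
    congr 1
    push_cast; ring
  have eN : ∀ t : ℝ, ∫ x in Set.Ioi (0:ℝ), (x : ℂ) ^ (-(σ : ℂ) - (t : ℂ) * Complex.I) ∂μ =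
      ∫ x : ℝ, Complex.exp (Complex.I * t * ((-Real.log x : ℝ) : ℂ)) ∂ν := by
    intro t
    rw [hνint]
    refine setIntegral_congr_fun measurableSet_Ioi fun x hx => ?_
    have hx0 : (0:ℝ) < x := hx
    have hxc : (x : ℂ) ≠ 0 := by exact_mod_cast hx0.ne'
    rw [Complex.ofReal_cpow hx0.le, Complex.cpow_def_of_ne_zero hxc,
      Complex.cpow_def_of_ne_zero hxc, ← Complex.exp_add, ← Complex.ofReal_log hx0.le]
    congr 1
    push_cast; ring
  simp_rw [eF, eN] at hlim
  rw [← core_aux g hgi C hgb ν Real.log Real.measurable_log hcont L hlim, hνint]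
  refine setIntegral_congr_fun measurableSet_Ioi fun x hx => ?_
  have hx0 : (0:ℝ) < x := hx
  simp only [hg]
  rw [Real.exp_log hx0, ← mul_assoc, ← Complex.ofReal_mul, ← Real.rpow_add hx0]
  simp
end

section
/- Let μ be a σ-finite Borel measure on the interval (0,1) whose Mellin transform satisfies ∫₀¹ x^{s-1} dμ(x) = 1/(ψ(s) - ψ(1)) for every real s > 1. Then μ is absolutely continuous with respect to Lebesgue measure, with a continuous density u on (0,1) satisfying u(x) = (6/π²)·x^{-1} + r(x) where |r(x)| ≤ C·x^{|s₁|}(1 + |log x|^{-1}) for all x ∈ (0,1) and some constant C, where s₁ ∈ (-1,0) is the unique root of ψ(s) = ψ(1) in (-1,0). Moreover μ((δ,1)) < ∞ for every δ > 0 and ∫₀¹ |r(x)| dx < ∞. -/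
open MeasureTheory

/-- The digamma function on the reals: `ψ(x) = Γ'(x)/Γ(x)`. -/
noncomputable def digamma (x : ℝ) : ℝ := deriv Real.Gamma x / Real.Gamma x


noncomputable def tm (n : ℕ) (s : ℝ) : ℝ := 1 / ((n:ℝ) + 1) - 1 / ((n:ℝ) + s)
noncomputable def fw (w : ℕ → ℝ) (s : ℝ) : ℝ := ∑' n, w n * tm n s
noncomputable def Dw (w : ℕ → ℝ) (s : ℝ) : ℝ := ∑' n, w n / ((n:ℝ) + s) ^ 2
noncomputable def wt (N n : ℕ) : ℝ := if n ∈ Finset.range (N + 1) then 1 else 0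

lemma sum_sq : Summable (fun n : ℕ => 1 / ((n:ℝ) + 1) ^ 2) := by
  have := (summable_nat_add_iff 1).2 (Real.summable_one_div_nat_pow.2 (le_refl 2))
  simpa using this

lemma good_ne {κ s : ℝ} (hκ : 0 < κ) (h : ∀ n : ℕ, κ * (n + 1) ≤ |(n:ℝ) + s|) (n : ℕ) :
    (n:ℝ) + s ≠ 0 := by
  intro h0
  have := h n
  rw [h0, abs_zero] at this
  have : 0 < κ * ((n:ℝ) + 1) := by positivity
  linarith

lemma tm_bound {κ s : ℝ} (hκ : 0 < κ) (h : ∀ n : ℕ, κ * (n + 1) ≤ |(n:ℝ) + s|) (n : ℕ) :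
    |tm n s| ≤ |s - 1| / κ * (1 / ((n:ℝ) + 1) ^ 2) := by
  have h1 := good_ne hκ h n
  have h2 : (0:ℝ) < (n:ℝ) + 1 := by positivity
  have e : tm n s = (s - 1) / (((n:ℝ) + 1) * ((n:ℝ) + s)) := by
    unfold tm; field_simp; ring
  rw [e, abs_div, abs_mul, abs_of_pos h2]
  have e2 : |s - 1| / κ * (1 / ((n:ℝ) + 1) ^ 2) = |s - 1| / (((n:ℝ) + 1) * (κ * ((n:ℝ) + 1))) := by
    field_simp
  rw [e2]
  gcongr
  exact h n

lemma sq_bound {κ s : ℝ} (hκ : 0 < κ) (h : ∀ n : ℕ, κ * (n + 1) ≤ |(n:ℝ) + s|) (n : ℕ) :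
    1 / ((n:ℝ) + s) ^ 2 ≤ 1 / κ ^ 2 * (1 / ((n:ℝ) + 1) ^ 2) := by
  have e2 : 1 / κ ^ 2 * (1 / ((n:ℝ) + 1) ^ 2) = 1 / (κ * ((n:ℝ) + 1)) ^ 2 := by
    field_simp
  rw [e2, ← sq_abs ((n:ℝ) + s)]
  gcongr
  exact h n

/-- weights in `[0,1]` -/
def W (w : ℕ → ℝ) : Prop := ∀ n, 0 ≤ w n ∧ w n ≤ 1

lemma W_abs {w : ℕ → ℝ} (hw : W w) (n : ℕ) : |w n| ≤ 1 := by
  rw [abs_of_nonneg (hw n).1]; exact (hw n).2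

lemma W_wt (N : ℕ) : W (wt N) := by
  intro n; unfold wt; split_ifs <;> norm_num

lemma W_one : W (fun _ => 1) := fun n => by norm_num

lemma wtm_bound {w : ℕ → ℝ} (hw : W w) {κ s : ℝ} (hκ : 0 < κ)
    (h : ∀ n : ℕ, κ * (n + 1) ≤ |(n:ℝ) + s|) (n : ℕ) :
    ‖w n * tm n s‖ ≤ |s - 1| / κ * (1 / ((n:ℝ) + 1) ^ 2) := by
  rw [Real.norm_eq_abs, abs_mul]
  calc |w n| * |tm n s| ≤ 1 * |tm n s| := by gcongr; exact W_abs hw n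
    _ = |tm n s| := one_mul _
    _ ≤ _ := tm_bound hκ h n

lemma wsq_bound {w : ℕ → ℝ} (hw : W w) {κ s : ℝ} (hκ : 0 < κ)
    (h : ∀ n : ℕ, κ * (n + 1) ≤ |(n:ℝ) + s|) (n : ℕ) :
    ‖w n / ((n:ℝ) + s) ^ 2‖ ≤ 1 / κ ^ 2 * (1 / ((n:ℝ) + 1) ^ 2) := by
  rw [Real.norm_eq_abs, abs_div, abs_of_nonneg (sq_nonneg ((n:ℝ) + s))]
  refine le_trans ?_ (sq_bound hκ h n)
  gcongr
  exact W_abs hw n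

lemma summ_tm {w : ℕ → ℝ} (hw : W w) {κ s : ℝ} (hκ : 0 < κ)
    (h : ∀ n : ℕ, κ * (n + 1) ≤ |(n:ℝ) + s|) : Summable (fun n => w n * tm n s) :=
  Summable.of_norm_bounded (sum_sq.mul_left _) (wtm_bound hw hκ h)

lemma summ_sq {w : ℕ → ℝ} (hw : W w) {κ s : ℝ} (hκ : 0 < κ)
    (h : ∀ n : ℕ, κ * (n + 1) ≤ |(n:ℝ) + s|) : Summable (fun n : ℕ => w n / ((n:ℝ) + s) ^ 2) :=
  Summable.of_norm_bounded (sum_sq.mul_left _) (wsq_bound hw hκ h)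

lemma good_pos {s : ℝ} (hs : 0 < s) : ∃ κ > 0, ∀ n : ℕ, κ * (n + 1) ≤ |(n:ℝ) + s| := by
  refine ⟨min s 1, by positivity, fun n => ?_⟩
  have : 0 ≤ (n:ℝ) := by positivity
  rw [abs_of_pos (by positivity)]
  nlinarith [min_le_left s 1, min_le_right s 1]

lemma good_int (j : ℕ) {a b : ℝ} (ha : -((j:ℝ) + 1) < a) (hb : b < -(j:ℝ)) :
    ∃ κ > 0, ∀ s ∈ Set.Icc a b, ∀ n : ℕ, κ * (n + 1) ≤ |(n:ℝ) + s| := by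
  obtain ⟨δ, hδ, h1, h2, h3⟩ : ∃ δ > 0, δ ≤ 1 ∧ δ ≤ a + j + 1 ∧ δ ≤ -j - b := by
    refine ⟨min 1 (min (a + j + 1) (-j - b)), ?_, ?_, ?_, ?_⟩
    · refine lt_min one_pos (lt_min (by linarith) (by linarith))
    · exact min_le_left _ _
    · exact (min_le_right _ _).trans (min_le_left _ _)
    · exact (min_le_right _ _).trans (min_le_right _ _)
  have hj : (0:ℝ) ≤ j := by positivity
  refine ⟨δ / (j + 2), by positivity, fun s hs n => ?_⟩
  have hn : (0:ℝ) ≤ n := by positivity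
  rw [div_mul_eq_mul_div, div_le_iff₀ (by positivity)]
  rcases le_or_gt n j with h | h
  · have h' : (n:ℝ) ≤ j := by exact_mod_cast h
    have h4 : δ ≤ |(n:ℝ) + s| := by
      rw [abs_of_nonpos (by linarith [hs.2])]; linarith [hs.2]
    calc δ * (n + 1) ≤ δ * (j + 2) := by gcongr; linarith
      _ ≤ _ := by gcongr
  · have h' : (j:ℝ) + 1 ≤ n := by exact_mod_cast h
    have h4 : (n:ℝ) - (j + 1) + δ ≤ |(n:ℝ) + s| := by
      refine le_trans ?_ (le_abs_self _); linarith [hs.1]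
    calc δ * (n + 1) = δ * (n - (j + 1)) + δ * (j + 2) := by ring
      _ ≤ (j + 2) * (n - (j + 1)) + δ * (j + 2) := by gcongr; linarith
      _ = (n - (j + 1) + δ) * (j + 2) := by ring
      _ ≤ _ := by gcongr

lemma good_pt (j : ℕ) {s : ℝ} (hs : s ∈ Set.Ioo (-((j:ℝ) + 1)) (-(j:ℝ))) :
    ∃ κ > 0, ∀ n : ℕ, κ * (n + 1) ≤ |(n:ℝ) + s| := by
  obtain ⟨κ, h, h'⟩ := good_int j hs.1 hs.2
  exact ⟨κ, h, h' s ⟨le_rfl, le_rfl⟩⟩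

lemma tm_lt (j : ℕ) {a b : ℝ} (ha : -((j:ℝ) + 1) < a) (hab : a < b) (hb : b < -(j:ℝ)) (n : ℕ) :
    tm n a < tm n b := by
  unfold tm
  have : 1 / ((n:ℝ) + b) < 1 / ((n:ℝ) + a) := by
    rcases le_or_gt n j with h | h
    · have h' : (n:ℝ) ≤ j := by exact_mod_cast h
      exact one_div_lt_one_div_of_neg_of_lt (by linarith) (by linarith)
    · have h' : (j:ℝ) + 1 ≤ n := by exact_mod_cast h
      exact one_div_lt_one_div_of_lt (by linarith) (by linarith)
  linarith

lemma fw_lt {w : ℕ → ℝ} (hw : W w) (j : ℕ) (hj : w j = 1) {a b : ℝ} (ha : -((j:ℝ) + 1) < a)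
    (hab : a < b) (hb : b < -(j:ℝ)) : fw w a < fw w b := by
  obtain ⟨κ, hκ, h1⟩ := good_pt j (s := a) ⟨ha, hab.trans hb⟩
  obtain ⟨κ', hκ', h2⟩ := good_pt j (s := b) ⟨ha.trans hab, hb⟩
  refine Summable.tsum_lt_tsum (i := j) (fun n => ?_) ?_ (summ_tm hw hκ h1) (summ_tm hw hκ' h2)
  · exact mul_le_mul_of_nonneg_left (tm_lt j ha hab hb n).le (hw n).1
  · rw [hj, one_mul, one_mul]; exact tm_lt j ha hab hb j

lemma fw_cont {w : ℕ → ℝ} (hw : W w) (j : ℕ) {a b : ℝ} (ha : -((j:ℝ) + 1) < a)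
    (hb : b < -(j:ℝ)) : ContinuousOn (fw w) (Set.Icc a b) := by
  obtain ⟨κ, hκ, h⟩ := good_int j ha hb
  refine continuousOn_tsum (u := fun n : ℕ => (|a| + |b| + 1) / κ * (1 / ((n:ℝ) + 1) ^ 2))
    (fun n => ?_) (sum_sq.mul_left _) (fun n s hs => ?_)
  · unfold tm
    refine continuousOn_const.mul (continuousOn_const.sub (continuousOn_const.div ?_ ?_))
    · fun_prop
    · intro s hs; exact good_ne hκ (h s hs) n
  · refine (wtm_bound hw hκ (h s hs) n).trans ?_
    gcongr
    have := abs_le_max_abs_abs hs.1 hs.2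
    have h3 : max |a| |b| ≤ |a| + |b| := max_le (by linarith [abs_nonneg b]) (by linarith [abs_nonneg a])
    calc |s - 1| ≤ |s| + |(1:ℝ)| := abs_sub _ _
      _ ≤ _ := by rw [abs_one]; linarith

/-- growth: f(s) - f(m) ≤ one term difference -/
lemma fw_sub_le {w : ℕ → ℝ} (hw : W w) (j : ℕ) {a b : ℝ} (ha : -((j:ℝ) + 1) < a)
    (hab : a < b) (hb : b < -(j:ℝ)) (i : ℕ) (hi : w i = 1) :
    tm i b - tm i a ≤ fw w b - fw w a := by
  obtain ⟨κ, hκ, h1⟩ := good_pt j (s := a) ⟨ha, hab.trans hb⟩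
  obtain ⟨κ', hκ', h2⟩ := good_pt j (s := b) ⟨ha.trans hab, hb⟩
  have s1 := summ_tm hw hκ h1
  have s2 := summ_tm hw hκ' h2
  unfold fw
  rw [← s2.tsum_sub s1]
  have := (s2.sub s1).le_tsum i (fun n _ => by
    have := mul_le_mul_of_nonneg_left (tm_lt j ha hab hb n).le (hw n).1
    linarith)
  simpa [hi] using this

lemma exists_root {w : ℕ → ℝ} (hw : W w) (j : ℕ) (hj : w j = 1) (hj1 : w (j + 1) = 1) :
    ∃ z ∈ Set.Ioo (-((j:ℝ) + 1)) (-(j:ℝ)), fw w z = 0 := by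
  set m : ℝ := -(j:ℝ) - 1 / 2 with hm
  -- left point
  have hK : 0 < |fw w m| + 3 := by positivity
  set δ : ℝ := 1 / (|fw w m| + 3) with hδ
  have hδ0 : 0 < δ := by positivity
  have hδ1 : δ < 1 / 2 := by
    rw [hδ]; exact one_div_lt_one_div_of_lt (by norm_num) (by linarith [abs_nonneg (fw w m)])
  have hδi : 1 / δ = |fw w m| + 3 := by rw [hδ]; simp
  have hl : fw w (-((j:ℝ) + 1) + δ) < 0 := by
    have := fw_sub_le hw j (a := -((j:ℝ) + 1) + δ) (b := m) (by linarith) (by linarith) (by linarith)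
      (j + 1) hj1
    unfold tm at this
    push_cast at this
    rw [show (j:ℝ) + 1 + (-((j:ℝ) + 1) + δ) = δ by ring, hδi,
      show (j:ℝ) + 1 + m = 1 / 2 by rw [hm]; ring, show (1:ℝ) / (1 / 2) = 2 by norm_num] at this
    linarith [le_abs_self (fw w m)]
  have hr : 0 < fw w (-(j:ℝ) - δ) := by
    have := fw_sub_le hw j (a := m) (b := -(j:ℝ) - δ) (by linarith) (by linarith) (by linarith)
      j hj
    unfold tm at this
    rw [show (j:ℝ) + (-(j:ℝ) - δ) = -δ by ring, one_div_neg_eq_neg_one_div, hδi,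
      show (j:ℝ) + m = -(1 / 2) by rw [hm]; ring, show (1:ℝ) / (-(1 / 2)) = -2 by norm_num] at this
    linarith [neg_abs_le (fw w m)]
  have hc := fw_cont hw j (a := -((j:ℝ) + 1) + δ) (b := -(j:ℝ) - δ) (by linarith) (by linarith)
  obtain ⟨z, hz, hz0⟩ := intermediate_value_Icc (by linarith) hc ⟨hl.le, hr.le⟩
  exact ⟨z, ⟨by linarith [hz.1], by linarith [hz.2]⟩, hz0⟩

lemma Dw_ge {w : ℕ → ℝ} (hw : W w) {κ s : ℝ} (hκ : 0 < κ)
    (h : ∀ n : ℕ, κ * (n + 1) ≤ |(n:ℝ) + s|) (i : ℕ) (hi : w i = 1) :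
    1 / ((i:ℝ) + s) ^ 2 ≤ Dw w s := by
  have := (summ_sq hw hκ h).le_tsum i (fun n _ => div_nonneg (hw n).1 (sq_nonneg _))
  simpa [hi, Dw] using this

lemma fw_wt (N : ℕ) (s : ℝ) : fw (wt N) s = ∑ n ∈ Finset.range (N + 1), tm n s := by
  unfold fw
  rw [tsum_eq_sum (s := Finset.range (N + 1))]
  · refine Finset.sum_congr rfl fun n hn => ?_
    simp only [wt, if_pos hn, one_mul]
  · intro n hn; simp only [wt, if_neg hn, zero_mul]

lemma Dw_wt (N : ℕ) (s : ℝ) :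
    Dw (wt N) s = ∑ n ∈ Finset.range (N + 1), 1 / ((n:ℝ) + s) ^ 2 := by
  unfold Dw
  rw [tsum_eq_sum (s := Finset.range (N + 1))]
  · refine Finset.sum_congr rfl fun n hn => ?_
    simp only [wt, if_pos hn]
  · intro n hn; simp only [wt, if_neg hn, zero_div]

lemma fw_wt_tendsto {κ s : ℝ} (hκ : 0 < κ) (h : ∀ n : ℕ, κ * (n + 1) ≤ |(n:ℝ) + s|) :
    Filter.Tendsto (fun N => fw (wt N) s) Filter.atTop (nhds (fw (fun _ => 1) s)) := by
  simp_rw [fw_wt]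
  have := (summ_tm W_one hκ h).hasSum.tendsto_sum_nat
  simp only [one_mul] at this
  have h2 : fw (fun _ => 1) s = ∑' n, tm n s := by simp [fw]
  rw [h2]
  exact this.comp (Filter.tendsto_add_atTop_nat 1)


section lagr
open Polynomial Lagrange

lemma partial_fin (N : ℕ) (v : ℕ → ℝ) (hinj : Set.InjOn v (Finset.range (N + 1)))
    (hv : ∀ k ∈ Finset.range (N + 1), ∀ n : ℕ, (n:ℝ) + v k ≠ 0)
    (hroot : ∀ k ∈ Finset.range (N + 1), fw (wt N) (v k) = 0)
    (s : ℝ) (hs : ∀ n : ℕ, (n:ℝ) + s ≠ 0) (hsv : ∀ k ∈ Finset.range (N + 1), s ≠ v k) :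
    1 / fw (wt N) s = 1 / (∑ n ∈ Finset.range (N + 1), 1 / ((n:ℝ) + 1)) +
      ∑ k ∈ Finset.range (N + 1), 1 / Dw (wt N) (v k) * (1 / (s - v k)) := by
  set A := Finset.range (N + 1) with hA
  set H : ℝ := ∑ n ∈ A, 1 / ((n:ℝ) + 1) with hH
  have hHpos : 0 < H := by
    apply Finset.sum_pos
    · intro n _; positivity
    · exact ⟨0, by simp [hA]⟩
  set P : ℝ[X] := nodal A (fun n : ℕ => -(n:ℝ)) with hP
  set Q : ℝ[X] := C H * P - derivative P with hQ
  have hPne : ∀ t : ℝ, (∀ n ∈ A, ((n:ℕ):ℝ) + t ≠ 0) → P.eval t ≠ 0 := by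
    intro t ht
    rw [hP, eval_nodal]
    refine Finset.prod_ne_zero_iff.2 fun n hn => ?_
    have := ht n hn
    rwa [sub_neg_eq_add, add_comm]
  have hP' : ∀ t : ℝ, (∀ n ∈ A, ((n:ℕ):ℝ) + t ≠ 0) →
      (derivative P).eval t = P.eval t * ∑ n ∈ A, 1 / ((n:ℝ) + t) := by
    intro t ht
    rw [hP, derivative_nodal, eval_finsetSum, Finset.mul_sum]
    refine Finset.sum_congr rfl fun n hn => ?_
    have h1 := ht n hn
    rw [nodal_eq_mul_nodal_erase hn]
    simp only [eval_mul, eval_sub, eval_X, eval_C]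
    rw [sub_neg_eq_add, add_comm t]
    field_simp
  have hQf : ∀ t : ℝ, (∀ n ∈ A, ((n:ℕ):ℝ) + t ≠ 0) → Q.eval t = P.eval t * fw (wt N) t := by
    intro t ht
    rw [hQ, fw_wt, eval_sub, hP' t ht]
    simp only [eval_mul, eval_C, tm, Finset.sum_sub_distrib]
    rw [← hA, ← hH]; ring
  have hdegP : P.degree = (N + 1 : ℕ) := by rw [hP, degree_nodal]; simp [hA]
  have hdegP' : (derivative P).degree < (A.card : ℕ) := by
    have : P ≠ 0 := nodal_ne_zero
    have := degree_derivative_lt this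
    rw [hdegP] at this
    simpa [hA] using this
  have hQn : Q = C H * nodal A v := by
    refine eq_of_degree_sub_lt_of_eval_index_eq A hinj ?_ ?_
    · have h1 : (C H * P - C H * nodal A v).degree < (A.card : ℕ) := by
        have e : (C H * P).degree = (A.card : ℕ) := by
          rw [degree_C_mul hHpos.ne', hP, degree_nodal]
        rw [← e]
        refine degree_sub_lt_left ?_ ?_ ?_
        · rw [e, degree_C_mul hHpos.ne', degree_nodal]
        · exact mul_ne_zero (by simpa using hHpos.ne') nodal_ne_zero
        · rw [leadingCoeff_mul, leadingCoeff_mul, hP, nodal_monic.leadingCoeff,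
            nodal_monic.leadingCoeff]
      have e : Q - C H * nodal A v = (C H * P - C H * nodal A v) - derivative P := by
        rw [hQ]; ring
      rw [e]
      exact (degree_sub_le _ _).trans_lt (max_lt h1 hdegP')
    · intro k hk
      rw [hQf _ (fun n _ => hv k hk n), hroot k hk, eval_mul, eval_nodal_at_node hk]; simp
  -- derivative at roots
  have hQd : ∀ k ∈ A, (derivative Q).eval (v k) = P.eval (v k) * Dw (wt N) (v k) := by
    intro k hk
    have hne := hv k hk
    have hd : HasDerivAt (fun t => P.eval t * fw (wt N) t)
        ((derivative P).eval (v k) * fw (wt N) (v k) + P.eval (v k) * Dw (wt N) (v k)) (v k) := by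
      refine (P.hasDerivAt (v k)).mul ?_
      have e : fw (wt N) = fun t => ∑ n ∈ A, tm n t := funext fun t => fw_wt N t
      rw [e, Dw_wt]
      refine HasDerivAt.fun_sum fun n _ => ?_
      unfold tm
      have h2 := ((hasDerivAt_id (v k)).const_add (n:ℝ)).inv (hne n)
      have h3 := h2.const_sub (1 / ((n:ℝ) + 1))
      convert h3 using 1
      · ext t; simp
      · simp [neg_div]
    have hev : (fun t => P.eval t * fw (wt N) t) =ᶠ[nhds (v k)] fun t => Q.eval t := by
      have h4 : ∀ᶠ t in nhds (v k), ∀ n ∈ A, (n:ℝ) + t ≠ 0 := by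
        rw [Filter.eventually_all_finset]
        intro n _
        have : ContinuousAt (fun t : ℝ => (n:ℝ) + t) (v k) := by fun_prop
        exact this.eventually_ne (hne n)
      filter_upwards [h4] with t ht
      exact (hQf t ht).symm
    have h5 := (hev.hasDerivAt_iff.1 hd).unique (Q.hasDerivAt (v k))
    rw [← h5, hroot k hk]; ring
  -- interpolation
  have hinteg : C H⁻¹ * derivative P = interpolate A v (fun k => P.eval (v k)) := by
    refine eq_interpolate_of_eval_eq _ hinj ?_ ?_
    · rw [degree_C_mul (inv_ne_zero hHpos.ne')]; exact hdegP'
    · intro k hk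
      have : Q.eval (v k) = 0 := by rw [hQf _ (fun n _ => hv k hk n), hroot k hk, mul_zero]
      rw [hQ] at this
      simp only [eval_sub, eval_mul, eval_C] at this ⊢
      rw [← sub_eq_zero.1 this]; field_simp
  have hev := congrArg (eval s) hinteg
  rw [eval_interpolate_not_at_node _ hsv] at hev
  have hQs : Q.eval s = H * (nodal A v).eval s := by rw [hQn]; simp
  have hns : (nodal A v).eval s ≠ 0 := eval_nodal_not_at_node hsv
  have hfs : fw (wt N) s ≠ 0 := by
    intro h0
    rw [hQf s (fun n _ => hs n), h0, mul_zero] at hQs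
    exact (mul_ne_zero hHpos.ne' hns) hQs.symm
  have hPs := hPne s (fun n _ => hs n)
  have hsum : ∑ k ∈ A, nodalWeight A v k * (s - v k)⁻¹ * P.eval (v k) =
      H * ∑ k ∈ A, 1 / Dw (wt N) (v k) * (1 / (s - v k)) := by
    rw [Finset.mul_sum]
    refine Finset.sum_congr rfl fun k hk => ?_
    have h1 := hQd k hk
    rw [nodalWeight_eq_eval_derivative_nodal hk]
    have h2 : H * (derivative (nodal A v)).eval (v k) = P.eval (v k) * Dw (wt N) (v k) := by
      rw [← h1, hQn]; simp
    have h3 := hPne _ (fun n _ => hv k hk n)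
    have h4 : Dw (wt N) (v k) ≠ 0 := by
      rw [Dw_wt]
      refine (Finset.sum_pos (fun n _ => ?_) ⟨0, by simp⟩).ne'
      have := hv k hk n
      positivity
    have h5 : (derivative (nodal A v)).eval (v k) = P.eval (v k) * Dw (wt N) (v k) / H := by
      field_simp; linarith
    rw [h5]
    field_simp
  rw [hsum] at hev
  simp only [eval_mul, eval_C] at hev
  have h6 : (derivative P).eval s = H * P.eval s - P.eval s * fw (wt N) s := by
    rw [← hQf s (fun n _ => hs n), hQ]; simp
  rw [h6] at hev
  have h7 : P.eval s * fw (wt N) s = H * (nodal A v).eval s := by rw [← hQs, hQf s (fun n _ => hs n)]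
  set S := ∑ k ∈ A, 1 / Dw (wt N) (v k) * (1 / (s - v k))
  set n0 := (nodal A v).eval s
  set p := P.eval s
  set f := fw (wt N) s
  have h8 : n0 = p * f / H := by field_simp; linarith
  rw [h8] at hev
  field_simp at hev ⊢
  linarith
end lagr


lemma Gamma_diff {s : ℝ} (hs : 0 < s) : DifferentiableAt ℝ Real.Gamma s := by
  refine Real.differentiableAt_Gamma fun m => ?_
  have : (0:ℝ) ≤ m := by positivity
  linarith

lemma digamma_add_one {s : ℝ} (hs : ∀ m : ℕ, s ≠ -(m:ℝ)) : digamma (s + 1) = digamma s + 1 / s := by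
  have hs0 : s ≠ 0 := by simpa using hs 0
  have hd := Real.differentiableAt_Gamma hs
  have hG := Real.Gamma_ne_zero hs
  have hev : (fun t => Real.Gamma (t + 1)) =ᶠ[nhds s] fun t => t * Real.Gamma t := by
    filter_upwards [eventually_ne_nhds hs0] with t ht
    exact Real.Gamma_add_one ht
  have h1 : deriv (fun t => Real.Gamma (t + 1)) s = deriv Real.Gamma (s + 1) :=
    deriv_comp_add_const _ _ _
  have h2 : deriv (fun t => t * Real.Gamma t) s = Real.Gamma s + s * deriv Real.Gamma s := by
    have := ((hasDerivAt_id' s).fun_mul hd.hasDerivAt).deriv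
    simpa using this
  unfold digamma
  rw [← h1, hev.deriv_eq, h2, Real.Gamma_add_one hs0]
  field_simp
  ring

lemma digamma_mono {a b : ℝ} (ha : 0 < a) (hab : a ≤ b) : digamma a ≤ digamma b := by
  have hconv := Real.convexOn_log_Gamma
  have hd : ∀ s : ℝ, 0 < s → HasDerivAt (Real.log ∘ Real.Gamma) (digamma s) s := by
    intro s hs
    exact (Gamma_diff hs).hasDerivAt.log (Real.Gamma_pos_of_pos hs).ne'
  have := hconv.monotoneOn_deriv (fun x hx => (hd x hx).differentiableAt)
  have h := this (Set.mem_Ioi.2 ha) (Set.mem_Ioi.2 (ha.trans_le hab)) hab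
  rwa [(hd a ha).deriv, (hd b (ha.trans_le hab)).deriv] at h

lemma digamma_add_nat {s : ℝ} (hs : ∀ m : ℕ, s ≠ -(m:ℝ)) (N : ℕ) :
    digamma (s + N) = digamma s + ∑ n ∈ Finset.range N, 1 / ((n:ℝ) + s) := by
  induction N with
  | zero => simp
  | succ N ih =>
    rw [Finset.sum_range_succ, ← add_assoc, ← ih]
    push_cast
    rw [← add_assoc, digamma_add_one, add_comm s]
    intro m h
    apply hs (m + N)
    push_cast; linarith

lemma digamma_sub (s : ℝ) (hs : ∀ m : ℕ, s ≠ -(m:ℝ)) (N : ℕ) :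
    digamma s - digamma 1 = ∑ n ∈ Finset.range N, tm n s + (digamma (s + N) - digamma (1 + N)) := by
  rw [digamma_add_nat hs, digamma_add_nat (s := 1)]
  · simp only [tm, Finset.sum_sub_distrib]; ring
  · intro m
    have : (0:ℝ) ≤ m := by positivity
    linarith

lemma digamma_asymp (s : ℝ) :
    Filter.Tendsto (fun N : ℕ => digamma (s + N) - digamma (1 + N)) Filter.atTop (nhds 0) := by
  obtain ⟨m, hm⟩ := exists_nat_ge (|s| + 1)
  have hms := abs_le.1 (show |s| ≤ m - 1 by linarith)
  -- upper: s + N ≤ (1 + N) + m; lower: s + N ≥ 1 + (N - m)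
  have hinv : ∀ c : ℝ, Filter.Tendsto (fun N : ℕ => (m:ℝ) * (1 / ((N:ℝ) + c))) Filter.atTop (nhds 0) := by
    intro c
    have h1 : Filter.Tendsto (fun N : ℕ => (N:ℝ) + c) Filter.atTop Filter.atTop :=
      Filter.tendsto_atTop_add_const_right _ _ tendsto_natCast_atTop_atTop
    have := (h1.inv_tendsto_atTop).const_mul (m:ℝ)
    simpa using this
  have hnat : ∀ t : ℝ, 0 < t → digamma (t + m) - digamma t ≤ m * (1 / t) := by
    intro t ht
    rw [digamma_add_nat]
    · have : ∑ n ∈ Finset.range m, 1 / ((n:ℝ) + t) ≤ ∑ n ∈ Finset.range m, 1 / t := by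
        refine Finset.sum_le_sum fun n _ => ?_
        gcongr
        have : (0:ℝ) ≤ n := by positivity
        linarith
      simp at this ⊢
      linarith
    · intro k
      have : (0:ℝ) ≤ k := by positivity
      linarith
  refine tendsto_of_tendsto_of_tendsto_of_le_of_le' (g := fun N : ℕ => -((m:ℝ) * (1 / ((N:ℝ) + (1 - m)))))
    (h := fun N : ℕ => (m:ℝ) * (1 / ((N:ℝ) + 1))) (by simpa using (hinv (1 - m)).neg) (hinv 1) ?_ ?_
  · filter_upwards [Filter.eventually_ge_atTop m] with N hN
    have hN' : (m:ℝ) ≤ N := by exact_mod_cast hN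
    have h1 := hnat ((N:ℝ) + (1 - m)) (by linarith)
    have h2 := digamma_mono (a := (N:ℝ) + (1 - m)) (b := s + N) (by linarith) (by linarith)
    rw [show (N:ℝ) + (1 - m) + m = 1 + N by ring] at h1
    linarith
  · filter_upwards [Filter.eventually_ge_atTop m] with N hN
    have hN' : (m:ℝ) ≤ N := by exact_mod_cast hN
    have h1 := hnat ((N:ℝ) + 1) (by linarith)
    have h2 := digamma_mono (a := s + N) (b := (N:ℝ) + 1 + m) (by linarith) (by linarith)
    rw [show 1 + (N:ℝ) = N + 1 by ring]
    linarith

lemma digamma_eq {κ s : ℝ} (hκ : 0 < κ) (h : ∀ n : ℕ, κ * (n + 1) ≤ |(n:ℝ) + s|) :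
    digamma s - digamma 1 = fw (fun _ => 1) s := by
  have hs : ∀ m : ℕ, s ≠ -(m:ℝ) := by
    intro m h0
    apply good_ne hκ h m; rw [h0]; ring
  have h1 := (summ_tm W_one hκ h).hasSum.tendsto_sum_nat
  have h2 := h1.add (digamma_asymp s)
  rw [add_zero] at h2
  refine tendsto_nhds_unique ?_ h2
  simp only [one_mul]
  simp_rw [← digamma_sub s hs]
  exact tendsto_const_nhds

/-- admissible position of the `k`-th root -/
def Pos (k : ℕ) (z : ℝ) : Prop :=
  0 < (k:ℝ) + z ∧ (k:ℝ) + z ≤ 1 ∧ ∃ κ > 0, ∀ n : ℕ, κ * (n + 1) ≤ |(n:ℝ) + z|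

lemma Pos_zero : Pos 0 1 := ⟨by norm_num, by norm_num, good_pos one_pos⟩

lemma Pos_succ {j : ℕ} {z : ℝ} (hz : z ∈ Set.Ioo (-((j:ℝ) + 1)) (-(j:ℝ))) : Pos (j + 1) z := by
  refine ⟨?_, ?_, good_pt j hz⟩ <;> push_cast <;> linarith [hz.1, hz.2]

lemma Pos.D_ge {k : ℕ} {z : ℝ} (h : Pos k z) {w : ℕ → ℝ} (hw : W w) (hk : w k = 1) :
    1 ≤ Dw w z := by
  obtain ⟨h1, h2, κ, hκ, h3⟩ := h
  refine le_trans ?_ (Dw_ge hw hκ h3 k hk)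
  rw [le_div_iff₀ (by positivity)]
  nlinarith

lemma fw_pos {s : ℝ} (hs : 1 < s) : 0 < fw (fun _ => 1) s := by
  obtain ⟨κ, hκ, h⟩ := good_pos (by linarith : 0 < s)
  have hp : ∀ n : ℕ, 0 < tm n s := by
    intro n
    unfold tm
    have := one_div_lt_one_div_of_lt (show (0:ℝ) < (n:ℝ) + 1 by positivity)
      (show (n:ℝ) + 1 < n + s by linarith)
    linarith
  refine (summ_tm W_one hκ h).tsum_pos (fun n => ?_) 0 ?_
  · rw [one_mul]; exact (hp n).le
  · rw [one_mul]; exact hp 0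

lemma fw_atTop : Filter.Tendsto (fw (fun _ => 1)) Filter.atTop Filter.atTop := by
  rw [Filter.tendsto_atTop]
  intro b
  obtain ⟨N, hN⟩ := (Real.tendsto_sum_range_one_div_nat_succ_atTop.eventually_ge_atTop (b + 1)).exists
  filter_upwards [Filter.eventually_gt_atTop (1:ℝ), Filter.eventually_ge_atTop (N:ℝ)] with t ht htN
  obtain ⟨κ, hκ, h⟩ := good_pos (by linarith : 0 < t)
  have hp : ∀ n : ℕ, 0 ≤ 1 * tm n t := by
    intro n
    unfold tm
    have := one_div_le_one_div_of_le (show (0:ℝ) < (n:ℝ) + 1 by positivity)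
      (show (n:ℝ) + 1 ≤ n + t by linarith)
    linarith
  have h1 := (summ_tm W_one hκ h).sum_le_tsum (Finset.range N) (fun n _ => hp n)
  have h2 : ∑ n ∈ Finset.range N, 1 / ((n:ℝ) + t) ≤ 1 := by
    calc ∑ n ∈ Finset.range N, 1 / ((n:ℝ) + t) ≤ ∑ n ∈ Finset.range N, 1 / t := by
          refine Finset.sum_le_sum fun n _ => ?_
          gcongr
          have : (0:ℝ) ≤ n := by positivity
          linarith
      _ = N / t := by simp [div_eq_mul_inv]
      _ ≤ 1 := by rw [div_le_one (by linarith)]; exact htN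
  have h3 : ∑ n ∈ Finset.range N, 1 * tm n t =
      ∑ n ∈ Finset.range N, 1 / ((n:ℝ) + 1) - ∑ n ∈ Finset.range N, 1 / ((n:ℝ) + t) := by
    simp [tm, Finset.sum_sub_distrib]
  rw [h3] at h1
  unfold fw
  linarith

lemma exists_V : ∃ V : ℕ → ℕ → ℝ, (∀ N, V N 0 = 1) ∧
    (∀ N j : ℕ, V N (j + 1) ∈ Set.Ioo (-((j:ℝ) + 1)) (-(j:ℝ))) ∧
    ∀ N j, j < N → fw (wt N) (V N (j + 1)) = 0 := by
  have : ∀ N j : ℕ, ∃ z ∈ Set.Ioo (-((j:ℝ) + 1)) (-(j:ℝ)), (j < N → fw (wt N) z = 0) := by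
    intro N j
    by_cases h : j < N
    · obtain ⟨z, hz, h0⟩ := exists_root (W_wt N) j
        (by unfold wt; rw [if_pos]; simp; omega) (by unfold wt; rw [if_pos]; simp; omega)
      exact ⟨z, hz, fun _ => h0⟩
    · exact ⟨-(j:ℝ) - 1 / 2, ⟨by linarith, by linarith⟩, fun h' => absurd h' h⟩
  choose z hz h0 using this
  exact ⟨fun N k => match k with | 0 => 1 | j + 1 => z N j, fun _ => rfl, hz, h0⟩

lemma V_tendsto {V : ℕ → ℕ → ℝ} 
    (hV : ∀ N j : ℕ, V N (j + 1) ∈ Set.Ioo (-((j:ℝ) + 1)) (-(j:ℝ)))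
    (hV0 : ∀ N j, j < N → fw (wt N) (V N (j + 1)) = 0) (j : ℕ) {z : ℝ}
    (hz : z ∈ Set.Ioo (-((j:ℝ) + 1)) (-(j:ℝ))) (hz0 : fw (fun _ => 1) z = 0) :
    Filter.Tendsto (fun N => V N (j + 1)) Filter.atTop (nhds z) := by
  rw [tendsto_order]
  constructor
  · intro a ha
    set a' := max a ((z - (j + 1)) / 2) with ha'
    have h1 : a' < z := max_lt ha (by linarith [hz.1])
    have h2 : -((j:ℝ) + 1) < a' := lt_of_lt_of_le (by linarith [hz.1]) (le_max_right _ _)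
    have h3 : fw (fun _ => 1) a' < 0 := by
      rw [← hz0]; exact fw_lt W_one j rfl h2 h1 hz.2
    obtain ⟨κ, hκ, h⟩ := good_pt j (s := a') ⟨h2, h1.trans hz.2⟩
    filter_upwards [(fw_wt_tendsto hκ h).eventually_lt_const h3, Filter.eventually_gt_atTop j]
      with N hN hjN
    refine lt_of_le_of_lt (le_max_left _ _ : a ≤ a') ?_
    by_contra hcon
    have hcon : V N (j + 1) ≤ a' := not_lt.1 hcon
    rcases hcon.eq_or_lt with he | hl
    · rw [← he, hV0 N j hjN] at hN; exact lt_irrefl _ hN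
    · have := fw_lt (W_wt N) j (by unfold wt; rw [if_pos]; simp; omega) (hV N j).1 hl (h1.trans hz.2)
      rw [hV0 N j hjN] at this; linarith
  · intro a ha
    set a' := min a ((z - j) / 2) with ha'
    have h1 : z < a' := lt_min ha (by linarith [hz.2])
    have h2 : a' < -(j:ℝ) := lt_of_le_of_lt (min_le_right _ _) (by linarith [hz.2])
    have h3 : 0 < fw (fun _ => 1) a' := by
      rw [← hz0]; exact fw_lt W_one j rfl hz.1 h1 h2
    obtain ⟨κ, hκ, h⟩ := good_pt j (s := a') ⟨hz.1.trans h1, h2⟩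
    filter_upwards [(fw_wt_tendsto hκ h).eventually_const_lt h3, Filter.eventually_gt_atTop j]
      with N hN hjN
    refine lt_of_lt_of_le ?_ (min_le_left _ _ : a' ≤ a)
    by_contra hcon
    have hcon : a' ≤ V N (j + 1) := not_lt.1 hcon
    rcases hcon.eq_or_lt with he | hl
    · rw [he, hV0 N j hjN] at hN; exact lt_irrefl _ hN
    · have := fw_lt (W_wt N) j (by unfold wt; rw [if_pos]; simp; omega) (hz.1.trans h1) hl (hV N j).2
      rw [hV0 N j hjN] at this; linarith

lemma wt_eventually (n : ℕ) : ∀ᶠ N in Filter.atTop, wt N n = 1 := by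
  filter_upwards [Filter.eventually_ge_atTop n] with N hN
  unfold wt; rw [if_pos]; simp; omega

lemma D_tendsto {x : ℕ → ℝ} {z κ : ℝ} (hκ : 0 < κ)
    (hx : ∀ᶠ N in Filter.atTop, ∀ n : ℕ, κ * (n + 1) ≤ |(n:ℝ) + x N|)
    (hz : ∀ n : ℕ, (n:ℝ) + z ≠ 0)
    (hxz : Filter.Tendsto x Filter.atTop (nhds z)) :
    Filter.Tendsto (fun N => Dw (wt N) (x N)) Filter.atTop (nhds (Dw (fun _ => 1) z)) := by
  refine tendsto_tsum_of_dominated_convergence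
    (bound := fun n : ℕ => 1 / κ ^ 2 * (1 / ((n:ℝ) + 1) ^ 2)) (sum_sq.mul_left _) (fun n => ?_) ?_
  · refine Filter.Tendsto.div ?_ ((hxz.const_add _).pow 2) (pow_ne_zero 2 (hz n))
    exact tendsto_const_nhds.congr' ((wt_eventually n).mono fun N h => h.symm)
  · filter_upwards [hx] with N hN n
    exact wsq_bound (W_wt N) hκ hN n

lemma v_Pos (v : ℕ → ℝ) (hv0 : v 0 = 1) (hv : ∀ j : ℕ, v (j + 1) ∈ Set.Ioo (-((j:ℝ) + 1)) (-(j:ℝ))) (k : ℕ) : Pos k (v k) := by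
  cases k with
  | zero => rw [hv0]; exact Pos_zero
  | succ j => exact Pos_succ (hv j)

lemma diff_formula (v : ℕ → ℝ) (hv0 : v 0 = 1) (hv : ∀ j : ℕ, v (j + 1) ∈ Set.Ioo (-((j:ℝ) + 1)) (-(j:ℝ)))
    (hvr : ∀ j : ℕ, fw (fun _ => 1) (v (j + 1)) = 0) {s t : ℝ} (hs : 1 < s) (ht : 1 < t) :
    HasSum (fun k => 1 / Dw (fun _ => 1) (v k) * (1 / (s - v k) - 1 / (t - v k)))
      (1 / fw (fun _ => 1) s - 1 / fw (fun _ => 1) t) := by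
  obtain ⟨V, hV0, hV, hVr⟩ := exists_V
  have hPos : ∀ N k, Pos k (V N k) := fun N k => v_Pos (V N) (hV0 N) (hV N) k
  have hvP : ∀ k, Pos k (v k) := v_Pos v hv0 hv
  have hlim : ∀ k, Filter.Tendsto (fun N => V N k) Filter.atTop (nhds (v k)) := by
    intro k
    cases k with
    | zero => simp only [hV0, hv0]; exact tendsto_const_nhds
    | succ j => exact V_tendsto hV hVr j (hv j) (hvr j)
  have hDlim : ∀ k, Filter.Tendsto (fun N => Dw (wt N) (V N k)) Filter.atTop
      (nhds (Dw (fun _ => 1) (v k))) := by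
    intro k
    have hne : ∀ n : ℕ, (n:ℝ) + v k ≠ 0 := by
      obtain ⟨_, _, κ, hκ, h⟩ := hvP k
      exact good_ne hκ h
    cases k with
    | zero =>
      obtain ⟨κ, hκ, h⟩ := good_pos (one_pos : (0:ℝ) < 1)
      refine D_tendsto hκ (Filter.Eventually.of_forall fun N => ?_) hne (hlim 0)
      rw [hV0]; exact h
    | succ j =>
      obtain ⟨h1, h2⟩ := hv j
      obtain ⟨κ, hκ, h⟩ := good_int j (a := (v (j + 1) - (j + 1)) / 2) (b := (v (j + 1) - j) / 2)
        (by linarith) (by linarith)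
      refine D_tendsto hκ ?_ hne (hlim (j + 1))
      filter_upwards [(hlim (j + 1)).eventually_const_le
        (show (v (j + 1) - (j + 1)) / 2 < v (j + 1) by linarith),
        (hlim (j + 1)).eventually_le_const (show v (j + 1) < (v (j + 1) - j) / 2 by linarith)]
        with N h3 h4
      exact h _ ⟨h3, h4⟩
  have hfin : ∀ N, ∀ s : ℝ, 1 < s → 1 / fw (wt N) s =
      1 / (∑ n ∈ Finset.range (N + 1), 1 / ((n:ℝ) + 1)) +
      ∑ k ∈ Finset.range (N + 1), 1 / Dw (wt N) (V N k) * (1 / (s - V N k)) := by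
    intro N s hs
    refine partial_fin N (V N) ?_ ?_ ?_ s ?_ ?_
    · intro k _ l _ hkl
      have h1 := hPos N k
      have h2 := hPos N l
      rw [hkl] at h1
      have h3 : (k:ℝ) < l + 1 := by linarith [h1.2.1, h2.1]
      have h4 : (l:ℝ) < k + 1 := by linarith [h2.2.1, h1.1]
      have h3 : k < l + 1 := by exact_mod_cast h3
      have h4 : l < k + 1 := by exact_mod_cast h4
      omega
    · intro k _
      obtain ⟨_, _, κ, hκ, h⟩ := hPos N k
      exact good_ne hκ h
    · intro k hk
      cases k with
      | zero => rw [hV0, fw_wt]; simp [tm]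
      | succ j => exact hVr N j (by simp at hk; omega)
    · intro n
      have : (0:ℝ) ≤ n := by positivity
      linarith
    · intro k _
      have := (hPos N k).2.1
      have : (0:ℝ) ≤ k := by positivity
      linarith
  have hkey : ∀ (k : ℕ) (z : ℝ), Pos k z → 1 / (s - z) - 1 / (t - z) = (t - s) / ((s - z) * (t - z))
      ∧ (min s t - 1) + k ≤ s - z ∧ (min s t - 1) + k ≤ t - z := by
    intro k z hz
    have h0 : (0:ℝ) ≤ k := by positivity
    have h1 := hz.2.1
    have h2 := min_le_left s t
    have h3 := min_le_right s t
    have h4 : s - z ≠ 0 := by linarith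
    have h5 : t - z ≠ 0 := by linarith
    refine ⟨by field_simp; ring, by linarith, by linarith⟩
  set m := min (min s t - 1) 1 with hm
  have hmpos : 0 < m := lt_min (by have := lt_min hs ht; linarith) one_pos
  have hbd : ∀ (k : ℕ) (z : ℝ), Pos k z → |1 / (s - z) - 1 / (t - z)| ≤
      |t - s| / m ^ 2 * (1 / ((k:ℝ) + 1) ^ 2) := by
    intro k z hz
    obtain ⟨h1, h2, h3⟩ := hkey k z hz
    have h0 : (0:ℝ) ≤ k := by positivity
    have h4 : m * (k + 1) ≤ (min s t - 1) + k := by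
      nlinarith [min_le_left (min s t - 1) 1, min_le_right (min s t - 1) 1]
    have h5 : 0 < m * ((k:ℝ) + 1) := by positivity
    have h6 : 0 < s - z := by linarith
    have h7 : 0 < t - z := by linarith
    rw [h1, abs_div, abs_of_pos (mul_pos h6 h7)]
    have e : |t - s| / m ^ 2 * (1 / ((k:ℝ) + 1) ^ 2) =
        |t - s| / ((m * (k + 1)) * (m * (k + 1))) := by field_simp
    rw [e]
    gcongr <;> linarith
  have hTan : Filter.Tendsto (fun N => ∑' k, wt N k *
      (1 / Dw (wt N) (V N k) * (1 / (s - V N k) - 1 / (t - V N k)))) Filter.atTop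
      (nhds (∑' k, 1 / Dw (fun _ => 1) (v k) * (1 / (s - v k) - 1 / (t - v k)))) := by
    refine tendsto_tsum_of_dominated_convergence
      (bound := fun k : ℕ => |t - s| / m ^ 2 * (1 / ((k:ℝ) + 1) ^ 2)) (sum_sq.mul_left _)
      (fun k => ?_) (Filter.Eventually.of_forall fun N k => ?_)
    · have h1 : Filter.Tendsto (fun N => wt N k) Filter.atTop (nhds 1) :=
        tendsto_const_nhds.congr' ((wt_eventually k).mono fun N h => h.symm)
      have hk := hkey k (v k) (hvP k)
      have h0 : (0:ℝ) ≤ k := by positivity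
      have hm1 := lt_min hs ht
      have hD := (hvP k).D_ge W_one rfl
      have h2 : Filter.Tendsto (fun N => 1 / Dw (wt N) (V N k) * (1 / (s - V N k) - 1 / (t - V N k)))
          Filter.atTop (nhds (1 / Dw (fun _ => 1) (v k) * (1 / (s - v k) - 1 / (t - v k)))) := by
        refine ((tendsto_const_nhds.div (hDlim k) (by linarith))).mul
          ((tendsto_const_nhds.div ((hlim k).const_sub s) ?_).sub
          (tendsto_const_nhds.div ((hlim k).const_sub t) ?_))
        · linarith [hk.2.1]
        · linarith [hk.2.2]
      simpa using h1.mul h2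
    · rw [Real.norm_eq_abs]
      refine le_trans ?_ (hbd k _ (hPos N k))
      by_cases hk : k ∈ Finset.range (N + 1)
      · have hw1 : wt N k = 1 := by simp only [wt, if_pos hk]
        have hD := (hPos N k).D_ge (W_wt N) hw1
        rw [hw1, one_mul, abs_mul]
        refine mul_le_of_le_one_left (abs_nonneg _) ?_
        rw [abs_of_nonneg (by positivity), div_le_one (by linarith)]
        exact hD
      · simp only [wt, if_neg hk, zero_mul, abs_zero]; exact abs_nonneg _
  have heq : ∀ N, ∑' k, wt N k * (1 / Dw (wt N) (V N k) * (1 / (s - V N k) - 1 / (t - V N k))) =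
      1 / fw (wt N) s - 1 / fw (wt N) t := by
    intro N
    rw [hfin N s hs, hfin N t ht, tsum_eq_sum (s := Finset.range (N + 1))]
    · rw [add_sub_add_left_eq_sub, ← Finset.sum_sub_distrib]
      refine Finset.sum_congr rfl fun k hk => ?_
      have hw1 : wt N k = 1 := by simp only [wt, if_pos hk]
      rw [hw1]; ring
    · intro k hk; simp only [wt, if_neg hk, zero_mul]
  have hl2 : Filter.Tendsto (fun N => 1 / fw (wt N) s - 1 / fw (wt N) t) Filter.atTop
      (nhds (1 / fw (fun _ => 1) s - 1 / fw (fun _ => 1) t)) := by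
    obtain ⟨κ, hκ, h⟩ := good_pos (by linarith : 0 < s)
    obtain ⟨κ', hκ', h'⟩ := good_pos (by linarith : 0 < t)
    exact (tendsto_const_nhds.div (fw_wt_tendsto hκ h) (fw_pos hs).ne').sub
      (tendsto_const_nhds.div (fw_wt_tendsto hκ' h') (fw_pos ht).ne')
  simp_rw [heq] at hTan
  rw [tendsto_nhds_unique hl2 hTan]
  refine Summable.hasSum (Summable.of_norm_bounded (sum_sq.mul_left (|t - s| / m ^ 2)) fun k => ?_)
  rw [Real.norm_eq_abs]
  refine le_trans ?_ (hbd k _ (hvP k))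
  have hD := (hvP k).D_ge W_one rfl
  rw [abs_mul]
  refine mul_le_of_le_one_left (abs_nonneg _) ?_
  rw [abs_of_nonneg (by positivity), div_le_one (by linarith)]
  exact hD

lemma partial_inf (v : ℕ → ℝ) (hv0 : v 0 = 1) (hv : ∀ j : ℕ, v (j + 1) ∈ Set.Ioo (-((j:ℝ) + 1)) (-(j:ℝ)))
    (hvr : ∀ j : ℕ, fw (fun _ => 1) (v (j + 1)) = 0) {s : ℝ} (hs : 1 < s) :
    HasSum (fun k => 1 / Dw (fun _ => 1) (v k) * (1 / (s - v k))) (1 / fw (fun _ => 1) s) := by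
  set c : ℕ → ℝ := fun k => 1 / Dw (fun _ => 1) (v k) with hc
  have hvP : ∀ k, Pos k (v k) := v_Pos v hv0 hv
  have hc0 : ∀ k, 0 ≤ c k := by
    intro k
    have hD := (hvP k).D_ge W_one rfl
    simp only [hc]; positivity
  have hv1 : ∀ k, v k ≤ 1 := by
    intro k
    have := (hvP k).2.1
    have h0 : (0:ℝ) ≤ k := by positivity
    linarith
  have hz : ∀ a : ℝ, Filter.Tendsto (fun t : ℝ => 1 / (t - a)) Filter.atTop (nhds 0) := by
    intro a
    have h1 : Filter.Tendsto (fun t : ℝ => t - a) Filter.atTop Filter.atTop :=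
      Filter.tendsto_atTop_add_const_right _ _ Filter.tendsto_id
    simp only [one_div]; exact h1.inv_tendsto_atTop
  have hFz : Filter.Tendsto (fun t : ℝ => 1 / fw (fun _ => 1) t) Filter.atTop (nhds 0) := by
    simp only [one_div]; exact fw_atTop.inv_tendsto_atTop
  have hsum : Summable (fun k => c k * (1 / (s - v k))) := by
    refine summable_of_sum_le (c := 1 / fw (fun _ => 1) s) (fun k => ?_) (fun u => ?_)
    · have := hv1 k
      exact mul_nonneg (hc0 k) (one_div_nonneg.2 (by linarith))
    · have hlim : Filter.Tendsto (fun t : ℝ => ∑ k ∈ u, c k * (1 / (s - v k) - 1 / (t - v k)))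
          Filter.atTop (nhds (∑ k ∈ u, c k * (1 / (s - v k) - 0))) :=
        tendsto_finsetSum _ fun k _ => (tendsto_const_nhds.sub (hz (v k))).const_mul _
      simp only [sub_zero] at hlim
      refine le_of_tendsto hlim ?_
      filter_upwards [Filter.eventually_gt_atTop s] with t ht
      have h1 := diff_formula v hv0 hv hvr hs (hs.trans ht)
      have h2 := sum_le_hasSum u (fun k _ => ?_) h1
      · have := one_div_pos.2 (fw_pos (hs.trans ht))
        linarith
      · refine mul_nonneg (hc0 k) ?_
        have := hv1 k
        have := one_div_le_one_div_of_le (show 0 < s - v k by linarith) (show s - v k ≤ t - v k by linarith)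
        linarith
  have hlim0 : Filter.Tendsto (fun t : ℝ => ∑' k, c k * (1 / (t - v k))) Filter.atTop
      (nhds (∑' _ : ℕ, (0:ℝ))) := by
    refine tendsto_tsum_of_dominated_convergence hsum (fun k => ?_) ?_
    · simpa using (hz (v k)).const_mul (c k)
    · filter_upwards [Filter.eventually_ge_atTop s] with t ht k
      have := hv1 k
      have h1 := one_div_le_one_div_of_le (show 0 < s - v k by linarith) (show s - v k ≤ t - v k by linarith)
      have h2 : 0 ≤ 1 / (t - v k) := one_div_nonneg.2 (by linarith)
      rw [Real.norm_eq_abs, abs_of_nonneg (mul_nonneg (hc0 k) h2)]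
      exact mul_le_mul_of_nonneg_left h1 (hc0 k)
  rw [tsum_zero] at hlim0
  have heq : ∀ t > s, ∑' k, c k * (1 / (s - v k)) - 1 / fw (fun _ => 1) s =
      ∑' k, c k * (1 / (t - v k)) - 1 / fw (fun _ => 1) t := by
    intro t ht
    have h1 := diff_formula v hv0 hv hvr hs (hs.trans ht)
    have h2 : HasSum (fun k => c k * (1 / (t - v k)))
        (∑' k, c k * (1 / (s - v k)) - (1 / fw (fun _ => 1) s - 1 / fw (fun _ => 1) t)) := by
      have h5 := hsum.hasSum.sub h1
      have e : (fun k => c k * (1 / (t - v k))) = fun k => c k * (1 / (s - v k)) -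
          c k * (1 / (s - v k) - 1 / (t - v k)) := by
        funext k; ring
      rw [e]; exact h5
    rw [h2.tsum_eq]; ring
  have h3 : Filter.Tendsto (fun _ : ℝ => ∑' k, c k * (1 / (s - v k)) - 1 / fw (fun _ => 1) s)
      Filter.atTop (nhds 0) := by
    have := hlim0.sub hFz
    rw [sub_zero] at this
    refine this.congr' ?_
    filter_upwards [Filter.eventually_gt_atTop s] with t ht
    exact (heq t ht).symm
  have h4 := tendsto_nhds_unique h3 tendsto_const_nhds
  rw [show 1 / fw (fun _ => 1) s = ∑' k, c k * (1 / (s - v k)) by linarith]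
  exact hsum.hasSum

lemma moment_unique {α β : Measure ℝ} [IsFiniteMeasure α] [IsFiniteMeasure β]
    (hα : ∀ᵐ x ∂α, x ∈ Set.Ioo (0:ℝ) 1) (hβ : ∀ᵐ x ∂β, x ∈ Set.Ioo (0:ℝ) 1)
    (h : ∀ n : ℕ, ∫ x, x ^ n ∂α = ∫ x, x ^ n ∂β) : α = β := by
  have hintg : ∀ (γ : Measure ℝ) [IsFiniteMeasure γ], (∀ᵐ x ∂γ, x ∈ Set.Ioo (0:ℝ) 1) →
      ∀ n : ℕ, Integrable (fun x : ℝ => x ^ n) γ := by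
    intro γ _ hγ n
    refine Integrable.of_bound (by fun_prop) 1 ?_
    filter_upwards [hγ] with x hx
    rw [Real.norm_eq_abs, abs_of_nonneg (pow_nonneg hx.1.le n)]
    exact pow_le_one₀ hx.1.le hx.2.le
  have hpi : ∀ (γ : Measure ℝ) [IsFiniteMeasure γ], (∀ᵐ x ∂γ, x ∈ Set.Ioo (0:ℝ) 1) →
      ∀ p : Polynomial ℝ, Integrable (fun x : ℝ => p.eval x) γ := by
    intro γ _ hγ p
    simp_rw [Polynomial.eval_eq_sum_range]
    exact integrable_finsetSum _ fun i _ => (hintg γ hγ i).const_mul _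
  have hp : ∀ p : Polynomial ℝ, ∫ x, p.eval x ∂α = ∫ x, p.eval x ∂β := by
    intro p
    simp_rw [Polynomial.eval_eq_sum_range]
    rw [integral_finsetSum _ fun i _ => (hintg α hα i).const_mul _,
      integral_finsetSum _ fun i _ => (hintg β hβ i).const_mul _]
    refine Finset.sum_congr rfl fun i _ => ?_
    rw [integral_const_mul, integral_const_mul, h i]
  refine ext_of_forall_integral_eq_of_IsFiniteMeasure fun f => ?_
  have hclose : ∀ (γ : Measure ℝ) [IsFiniteMeasure γ], (∀ᵐ x ∂γ, x ∈ Set.Ioo (0:ℝ) 1) →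
      ∀ (p : Polynomial ℝ) (ε : ℝ), (∀ x ∈ Set.Icc (0:ℝ) 1, |p.eval x - f x| < ε) →
      |∫ x, p.eval x ∂γ - ∫ x, f x ∂γ| ≤ ε * γ.real Set.univ := by
    intro γ _ hγ p ε hpe
    rw [← integral_sub (hpi γ hγ p) (f.integrable γ)]
    rw [← Real.norm_eq_abs]
    refine norm_integral_le_of_norm_le_const (μ := γ) ?_
    filter_upwards [hγ] with x hx
    exact (hpe x ⟨hx.1.le, hx.2.le⟩).le
  set M := α.real Set.univ + β.real Set.univ with hM
  have hM0 : 0 ≤ M := by positivity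
  refine eq_of_forall_dist_le fun ε hε => ?_
  obtain ⟨p, hpf⟩ := exists_polynomial_near_of_continuousOn 0 1 f f.continuous.continuousOn
    (ε / (M + 1)) (by positivity)
  have h1 := hclose α hα p _ hpf
  have h2 := hclose β hβ p _ hpf
  rw [hp p] at h1
  rw [Real.dist_eq]
  have h3 : ε / (M + 1) * M ≤ ε := by
    rw [div_mul_eq_mul_div, div_le_iff₀ (by positivity)]; nlinarith
  have h4 : ε / (M + 1) * α.real Set.univ + ε / (M + 1) * β.real Set.univ ≤ ε := by
    rw [← mul_add]; exact h3
  rw [abs_le] at h1 h2 ⊢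
  constructor <;> linarith [h1.1, h1.2, h2.1, h2.2]

lemma measure_unique {μ ν : Measure ℝ} (hμ : ∀ᵐ x ∂μ, x ∈ Set.Ioo (0:ℝ) 1)
    (hν : ∀ᵐ x ∂ν, x ∈ Set.Ioo (0:ℝ) 1)
    (hfin : ∫⁻ x, ENNReal.ofReal x ∂μ ≠ ⊤)
    (h : ∀ n : ℕ, ∫⁻ x, ENNReal.ofReal (x ^ (n + 1)) ∂μ = ∫⁻ x, ENNReal.ofReal (x ^ (n + 1)) ∂ν) :
    μ = ν := by
  have hm : Measurable (fun x : ℝ => ENNReal.ofReal x) := ENNReal.measurable_ofReal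
  have hfin' : ∫⁻ x, ENNReal.ofReal x ∂ν ≠ ⊤ := by
    have := h 0
    simp only [zero_add, pow_one] at this
    rw [← this]; exact hfin
  have : IsFiniteMeasure (μ.withDensity (fun x => ENNReal.ofReal x)) := isFiniteMeasure_withDensity hfin
  have : IsFiniteMeasure (ν.withDensity (fun x => ENNReal.ofReal x)) := isFiniteMeasure_withDensity hfin'
  have hmom : ∀ γ : Measure ℝ, (∀ᵐ x ∂γ, x ∈ Set.Ioo (0:ℝ) 1) → ∀ n : ℕ,
      ∫ x, x ^ n ∂(γ.withDensity (fun x => ENNReal.ofReal x)) =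
        (∫⁻ x, ENNReal.ofReal (x ^ (n + 1)) ∂γ).toReal := by
    intro γ hγ n
    have hac : ∀ᵐ x ∂(γ.withDensity (fun x => ENNReal.ofReal x)), x ∈ Set.Ioo (0:ℝ) 1 :=
      (withDensity_absolutelyContinuous _ _).ae_le hγ
    rw [integral_eq_lintegral_of_nonneg_ae (hac.mono fun x hx => pow_nonneg hx.1.le n) (by fun_prop),
      lintegral_withDensity_eq_lintegral_mul _ hm (by fun_prop)]
    congr 1
    refine lintegral_congr_ae (hγ.mono fun x hx => ?_)
    simp only [Pi.mul_apply]
    rw [← ENNReal.ofReal_mul hx.1.le, pow_succ']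
  have heq : μ.withDensity (fun x => ENNReal.ofReal x) = ν.withDensity (fun x => ENNReal.ofReal x) := by
    refine moment_unique ((withDensity_absolutelyContinuous _ _).ae_le hμ)
      ((withDensity_absolutelyContinuous _ _).ae_le hν) fun n => ?_
    rw [hmom μ hμ, hmom ν hν, h n]
  have hback : ∀ γ : Measure ℝ, (∀ᵐ x ∂γ, x ∈ Set.Ioo (0:ℝ) 1) →
      (γ.withDensity (fun x => ENNReal.ofReal x)).withDensity (fun x => (ENNReal.ofReal x)⁻¹) = γ := by
    intro γ hγ
    exact withDensity_inv_same hm (hγ.mono fun x hx => by simpa using hx.1)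
      (Filter.Eventually.of_forall fun x => ENNReal.ofReal_ne_top)
  rw [← hback μ hμ, heq, hback ν hν]

lemma lint_rpow {p : ℝ} (hp : 0 ≤ p) {c : ℝ} (hc : 0 ≤ c) :
    ∫⁻ x in Set.Ioo (0:ℝ) 1, ENNReal.ofReal (c * x ^ p) = ENNReal.ofReal (c * (1 / (p + 1))) := by
  have h1 : IntegrableOn (fun x : ℝ => c * x ^ p) (Set.Ioo 0 1) := by
    have := (intervalIntegral.intervalIntegrable_rpow' (a := 0) (b := 1) (r := p) (by linarith))
    rw [intervalIntegrable_iff_integrableOn_Ioo_of_le zero_le_one] at this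
    exact this.const_mul c
  rw [← ofReal_integral_eq_lintegral_ofReal h1]
  · rw [integral_const_mul, ← integral_Ioc_eq_integral_Ioo,
      ← intervalIntegral.integral_of_le zero_le_one, integral_rpow (Or.inl (by linarith))]
    rw [Real.one_rpow, Real.zero_rpow (by linarith), sub_zero]
  · refine (ae_restrict_mem measurableSet_Ioo).mono fun x hx => ?_
    exact mul_nonneg hc (Real.rpow_nonneg hx.1.le _)

lemma Dw_one : Dw (fun _ => 1) 1 = Real.pi ^ 2 / 6 := by
  unfold Dw
  have h := (hasSum_nat_add_iff (f := fun n : ℕ => (1:ℝ) / (n:ℝ) ^ 2) (g := Real.pi ^ 2 / 6) 1).2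
    (by simpa using hasSum_zeta_two)
  simpa using h.tsum_eq

/--
Let `μ` be a σ-finite Borel measure on the interval `(0,1)` whose Mellin transform satisfies
`∫₀¹ x^{s-1} dμ(x) = 1/(ψ(s) - ψ(1))` for every real `s > 1`. Then `μ` is absolutely continuous
with respect to Lebesgue measure, with a continuous density `u` on `(0,1)` satisfying
`u(x) = (6/π²)·x⁻¹ + r(x)` where `|r(x)| ≤ C·x^{|s₁|}(1 + |log x|⁻¹)` for all `x ∈ (0,1)` and
some constant `C`, where `s₁ ∈ (-1,0)` is the unique root of `ψ(s) = ψ(1)` in `(-1,0)`.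
Moreover `μ((δ,1)) < ∞` for every `δ > 0` and `∫₀¹ |r(x)| dx < ∞`.
-/
theorem stmt9 (μ : Measure ℝ) [SigmaFinite μ]
    (hsupp : μ (Set.Ioo (0:ℝ) 1)ᶜ = 0)
    (hMellin : ∀ s : ℝ, 1 < s →
      ∫ x in Set.Ioo (0:ℝ) 1, x ^ (s - 1) ∂μ = 1 / (digamma s - digamma 1))
    (s₁ : ℝ) (hs₁ : s₁ ∈ Set.Ioo (-1:ℝ) 0) (hroot : digamma s₁ = digamma 1) :
    ∃ u : ℝ → ℝ,
      ContinuousOn u (Set.Ioo 0 1) ∧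
      μ = volume.withDensity (fun x => ENNReal.ofReal ((Set.Ioo (0:ℝ) 1).indicator u x)) ∧
      (∃ C : ℝ, ∀ x ∈ Set.Ioo (0:ℝ) 1,
        |u x - (6 / Real.pi ^ 2) * x⁻¹| ≤ C * x ^ |s₁| * (1 + |Real.log x|⁻¹)) ∧
      (∀ δ : ℝ, 0 < δ → μ (Set.Ioo δ 1) < ⊤) ∧
      IntegrableOn (fun x => u x - (6 / Real.pi ^ 2) * x⁻¹) (Set.Ioo 0 1) := by
  -- the roots
  have hex : ∀ j : ℕ, ∃ z ∈ Set.Ioo (-((j:ℝ) + 1)) (-(j:ℝ)), fw (fun _ => 1) z = 0 ∧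
      (j = 0 → z = s₁) := by
    intro j
    by_cases hj : j = 0
    · subst hj
      have hm : s₁ ∈ Set.Ioo (-(((0:ℕ):ℝ) + 1)) (-((0:ℕ):ℝ)) := by simpa using hs₁
      obtain ⟨κ, hκ, h⟩ := good_pt 0 hm
      refine ⟨s₁, hm, ?_, fun _ => rfl⟩
      rw [← digamma_eq hκ h, hroot, sub_self]
    · obtain ⟨z, hz, h0⟩ := exists_root W_one j rfl rfl
      exact ⟨z, hz, h0, fun h => absurd h hj⟩
  choose z hz hz0 hzs using hex
  obtain ⟨v, hv0, hv, hvr, hvs⟩ : ∃ v : ℕ → ℝ, v 0 = 1 ∧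
      (∀ j : ℕ, v (j + 1) ∈ Set.Ioo (-((j:ℝ) + 1)) (-(j:ℝ))) ∧
      (∀ j : ℕ, fw (fun _ => 1) (v (j + 1)) = 0) ∧ v 1 = s₁ :=
    ⟨fun k => match k with | 0 => 1 | j + 1 => z j, rfl, hz, hz0, hzs 0 rfl⟩
  have hvP : ∀ k, Pos k (v k) := v_Pos v hv0 hv
  obtain ⟨c, hc⟩ : ∃ c : ℕ → ℝ, c = fun k => 1 / Dw (fun _ => 1) (v k) := ⟨_, rfl⟩
  have hpf : ∀ s : ℝ, 1 < s → HasSum (fun k => c k * (1 / (s - v k))) (1 / fw (fun _ => 1) s) :=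
    fun s hs => by rw [hc]; exact partial_inf v hv0 hv hvr hs
  have hcb : ∀ k, 0 ≤ c k ∧ c k ≤ 1 := by
    intro k
    have hD := (hvP k).D_ge W_one rfl
    refine ⟨by simp only [hc]; positivity, ?_⟩
    simp only [hc]
    rw [div_le_one (by linarith)]; exact hD
  have hv1 : ∀ k, v k ≤ 1 := by
    intro k
    have := (hvP k).2.1
    have h0 : (0:ℝ) ≤ k := by positivity
    linarith
  have hc0 : c 0 = 6 / Real.pi ^ 2 := by
    simp only [hc, hv0, Dw_one, one_div_div]
  -- the remainder
  obtain ⟨T, hT⟩ : ∃ T : ℕ → ℝ → ℝ, T = fun k x => c k * x ^ (-v k) := ⟨_, rfl⟩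
  obtain ⟨r, hr⟩ : ∃ r : ℝ → ℝ, r = fun x => ∑' k, T (k + 1) x := ⟨_, rfl⟩
  have hT0 : ∀ k, ∀ x ∈ Set.Ioo (0:ℝ) 1, 0 ≤ T k x := fun k x hx => by
    rw [hT]; exact mul_nonneg (hcb k).1 (Real.rpow_nonneg hx.1.le _)
  have hTb : ∀ k : ℕ, ∀ x ∈ Set.Ioo (0:ℝ) 1, T (k + 1) x ≤ x ^ k := by
    intro k x hx
    have h1 : x ^ (-v (k + 1)) ≤ x ^ (k:ℝ) :=
      Real.rpow_le_rpow_of_exponent_ge hx.1 hx.2.le (by linarith [(hv k).2])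
    rw [Real.rpow_natCast] at h1
    calc T (k + 1) x ≤ 1 * x ^ (-v (k + 1)) := by
          rw [hT]
          exact mul_le_mul_of_nonneg_right (hcb (k + 1)).2 (Real.rpow_nonneg hx.1.le _)
      _ ≤ _ := by rw [one_mul]; exact h1
  have hTs : ∀ x ∈ Set.Ioo (0:ℝ) 1, Summable (fun k => T (k + 1) x) := fun x hx =>
    Summable.of_nonneg_of_le (fun k => hT0 _ x hx) (fun k => hTb k x hx)
      (summable_geometric_of_lt_one hx.1.le hx.2)
  have hr0 : ∀ x ∈ Set.Ioo (0:ℝ) 1, 0 ≤ r x := fun x hx => by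
    rw [hr]; exact tsum_nonneg fun k => hT0 _ x hx
  have hrc : ContinuousOn r (Set.Ioo 0 1) := by
    intro x hx
    set b := (x + 1) / 2 with hb
    have hxb : x ∈ Set.Ioo 0 b := ⟨hx.1, by linarith [hx.2]⟩
    have hb1 : b < 1 := by linarith [hx.2]
    have hb0 : 0 < b := by linarith [hx.1]
    have : ContinuousOn r (Set.Ioo 0 b) := by
      rw [hr]
      refine continuousOn_tsum (u := fun k => b ^ k) (fun k => ?_)
        (summable_geometric_of_lt_one hb0.le hb1) (fun k y hy => ?_)
      · rw [hT]
        refine continuousOn_const.mul (ContinuousOn.rpow_const continuousOn_id fun y hy => ?_)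
        exact Or.inl hy.1.ne'
      · have hy' : y ∈ Set.Ioo (0:ℝ) 1 := ⟨hy.1, hy.2.trans hb1⟩
        rw [Real.norm_eq_abs, abs_of_nonneg (hT0 _ y hy')]
        exact (hTb k y hy').trans (pow_le_pow_left₀ hy.1.le hy.2.le k)
    exact (this.continuousAt (Ioo_mem_nhds hxb.1 hxb.2)).continuousWithinAt
  obtain ⟨u, hu⟩ : ∃ u : ℝ → ℝ, u = fun x => 6 / Real.pi ^ 2 * x⁻¹ + r x := ⟨_, rfl⟩
  have hur : ∀ x, u x - 6 / Real.pi ^ 2 * x⁻¹ = r x := fun x => by simp only [hu]; ring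
  have huT : ∀ x ∈ Set.Ioo (0:ℝ) 1, HasSum (fun k => T k x) (u x) := by
    intro x hx
    have h1 : T 0 x = 6 / Real.pi ^ 2 * x⁻¹ := by
      simp only [hT]; rw [hc0, hv0, Real.rpow_neg_one]
    have h2 := (hasSum_nat_add_iff (f := fun k => T k x) 1).1 (hTs x hx).hasSum
    simp only [Finset.range_one, Finset.sum_singleton] at h2
    rw [h1, add_comm] at h2
    rw [hu, hr]; exact h2
  -- support
  have hμ : ∀ᵐ x ∂μ, x ∈ Set.Ioo (0:ℝ) 1 := hsupp
  have hres : μ.restrict (Set.Ioo (0:ℝ) 1) = μ := Measure.restrict_eq_self_of_ae_mem hμ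
  rw [hres] at hMellin
  have hμpow : ∀ n : ℕ, ∫⁻ x, ENNReal.ofReal (x ^ (n + 1)) ∂μ =
      ENNReal.ofReal (1 / fw (fun _ => 1) ((n:ℝ) + 2)) := by
    intro n
    have hn : (1:ℝ) < (n:ℝ) + 2 := by
      have : (0:ℝ) ≤ n := by positivity
      linarith
    obtain ⟨κ, hκ, h⟩ := good_pos (show (0:ℝ) < (n:ℝ) + 2 by linarith)
    have h1 := hMellin ((n:ℝ) + 2) hn
    rw [digamma_eq hκ h] at h1
    have e : ∀ x : ℝ, x ^ ((n:ℝ) + 2 - 1) = x ^ (n + 1) := by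
      intro x
      rw [show (n:ℝ) + 2 - 1 = ((n + 1 : ℕ) : ℝ) by push_cast; ring, Real.rpow_natCast]
    simp_rw [e] at h1
    have hinteg : Integrable (fun x : ℝ => x ^ (n + 1)) μ := by
      by_contra hcon
      rw [integral_undef hcon] at h1
      have := one_div_pos.2 (fw_pos hn)
      linarith
    rw [← h1, ofReal_integral_eq_lintegral_ofReal hinteg]
    exact hμ.mono fun x hx => pow_nonneg hx.1.le _
  have hfin : ∫⁻ x, ENNReal.ofReal x ∂μ ≠ ⊤ := by
    have := hμpow 0
    simp only [zero_add, pow_one] at this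
    rw [this]; exact ENNReal.ofReal_ne_top
  refine ⟨u, ?_, ?_, ⟨2, fun x hx => ?_⟩, fun δ hδ => ?_, ?_⟩
  · rw [hu]
    exact (continuousOn_const.mul (continuousOn_inv₀.mono fun x hx => hx.1.ne')).add hrc
  · -- identification of the measure
    set g : ℝ → ENNReal := fun x => ∑' k, ENNReal.ofReal (T k x) with hg
    have hTm : ∀ k, Measurable (T k) := fun k => by simp only [hT]; fun_prop
    have hgm : Measurable g := Measurable.ennreal_tsum fun k => (hTm k).ennreal_ofReal
    have hdens : (fun x => ENNReal.ofReal ((Set.Ioo (0:ℝ) 1).indicator u x)) =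
        (Set.Ioo (0:ℝ) 1).indicator g := by
      funext x
      by_cases hx : x ∈ Set.Ioo (0:ℝ) 1
      · rw [Set.indicator_of_mem hx, Set.indicator_of_mem hx, ← (huT x hx).tsum_eq]
        exact ENNReal.ofReal_tsum_of_nonneg (fun k => hT0 k x hx) (huT x hx).summable
      · rw [Set.indicator_of_notMem hx, Set.indicator_of_notMem hx, ENNReal.ofReal_zero]
    rw [hdens, withDensity_indicator measurableSet_Ioo]
    refine measure_unique hμ ?_ hfin fun n => ?_
    · exact (withDensity_absolutelyContinuous _ _).ae_le (ae_restrict_mem measurableSet_Ioo)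
    · rw [hμpow, lintegral_withDensity_eq_lintegral_mul _ hgm (by fun_prop)]
      have hn : (1:ℝ) < (n:ℝ) + 2 := by
        have : (0:ℝ) ≤ n := by positivity
        linarith
      have h1 : ∫⁻ x in Set.Ioo (0:ℝ) 1, (g * fun x => ENNReal.ofReal (x ^ (n + 1))) x =
          ∫⁻ x in Set.Ioo (0:ℝ) 1, ∑' k, ENNReal.ofReal (c k * x ^ ((n:ℝ) + 1 - v k)) := by
        refine setLIntegral_congr_fun measurableSet_Ioo fun x hx => ?_
        simp only [Pi.mul_apply, hg]
        rw [← ENNReal.tsum_mul_right]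
        refine tsum_congr fun k => ?_
        rw [← ENNReal.ofReal_mul (hT0 k x hx)]
        congr 1
        simp only [hT]
        rw [mul_assoc, ← Real.rpow_natCast, ← Real.rpow_add hx.1]
        congr 2
        push_cast; ring
      rw [h1, lintegral_tsum (fun k => by fun_prop)]
      have h2 := hpf ((n:ℝ) + 2) hn
      have hnn : ∀ k, 0 ≤ c k * (1 / ((n:ℝ) + 2 - v k)) := fun k =>
        mul_nonneg (hcb k).1 (one_div_nonneg.2 (by linarith [hv1 k]))
      rw [← h2.tsum_eq, ENNReal.ofReal_tsum_of_nonneg hnn h2.summable]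
      refine tsum_congr fun k => ?_
      rw [lint_rpow (by linarith [hv1 k]) (hcb k).1]
      congr 3
      ring
  · -- the bound
    rw [hur, abs_of_nonneg (hr0 x hx)]
    have hs0 : |s₁| = -s₁ := abs_of_neg hs₁.2
    have hsplit : r x = T 1 x + ∑' k, T (k + 2) x := by
      simp only [hr]
      rw [(hTs x hx).tsum_eq_zero_add]
    have hgeo : ∑' k, T (k + 2) x ≤ x / (1 - x) := by
      have h1 : Summable (fun k => T (k + 2) x) := (summable_nat_add_iff 1).2 (hTs x hx)
      have h2 : HasSum (fun k : ℕ => x * x ^ k) (x * (1 - x)⁻¹) :=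
        (hasSum_geometric_of_lt_one hx.1.le hx.2).mul_left x
      rw [div_eq_mul_inv, ← h2.tsum_eq]
      refine h1.tsum_le_tsum (fun k => ?_) h2.summable
      rw [← pow_succ']
      exact hTb (k + 1) x hx
    have hT1 : T 1 x ≤ x ^ |s₁| := by
      simp only [hT]
      rw [hvs, hs0]
      exact mul_le_of_le_one_left (Real.rpow_nonneg hx.1.le _) (hcb 1).2
    have hxs : x ≤ x ^ |s₁| := by
      have := Real.rpow_le_rpow_of_exponent_ge hx.1 hx.2.le (show |s₁| ≤ 1 by rw [hs0]; linarith [hs₁.1])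
      rwa [Real.rpow_one] at this
    have hlog : Real.log x < 0 := Real.log_neg hx.1 hx.2
    have hx1 : 0 < 1 - x := by linarith [hx.2]
    have hL : x / (1 - x) ≤ |Real.log x|⁻¹ := by
      have h1 := Real.log_le_sub_one_of_pos (inv_pos.2 hx.1)
      rw [Real.log_inv] at h1
      rw [abs_of_neg hlog]
      have h2 : x / (1 - x) = (x⁻¹ - 1)⁻¹ := by
        have := hx.1.ne'
        have e : x⁻¹ - 1 = (1 - x) / x := by field_simp
        rw [e, inv_div]
      rw [h2]
      exact inv_anti₀ (by linarith) h1
    have hL0 : 0 ≤ |Real.log x|⁻¹ := by positivity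
    have h3 : x / (1 - x) = x * (1 + x / (1 - x)) := by field_simp; ring
    have h4 : x / (1 - x) ≤ x ^ |s₁| * (1 + |Real.log x|⁻¹) := by
      rw [h3]
      have : 0 ≤ x / (1 - x) := div_nonneg hx.1.le hx1.le
      have : 0 ≤ x ^ |s₁| := Real.rpow_nonneg hx.1.le _
      gcongr
    have h5 : 0 ≤ x ^ |s₁| * |Real.log x|⁻¹ := mul_nonneg (Real.rpow_nonneg hx.1.le _) hL0
    rw [hsplit]
    calc T 1 x + ∑' k, T (k + 2) x ≤ x ^ |s₁| + x ^ |s₁| * (1 + |Real.log x|⁻¹) := by linarith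
      _ ≤ 2 * x ^ |s₁| * (1 + |Real.log x|⁻¹) := by linarith
  · -- finiteness
    have h1 := mul_meas_ge_le_lintegral (μ := μ) ENNReal.measurable_ofReal (ENNReal.ofReal δ)
    have h2 : μ (Set.Ioo δ 1) ≤ μ {x | ENNReal.ofReal δ ≤ ENNReal.ofReal x} :=
      measure_mono fun x hx => ENNReal.ofReal_le_ofReal hx.1.le
    refine h2.trans_lt ?_
    by_contra hcon
    rw [not_lt, top_le_iff] at hcon
    rw [hcon, ENNReal.mul_top (by simpa using hδ)] at h1
    exact hfin (top_le_iff.1 h1)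
  · -- integrability
    simp_rw [hur]
    refine ⟨hrc.aestronglyMeasurable measurableSet_Ioo, ?_⟩
    rw [hasFiniteIntegral_iff_ofReal ((ae_restrict_mem measurableSet_Ioo).mono hr0)]
    have h1 : ∫⁻ x in Set.Ioo (0:ℝ) 1, ENNReal.ofReal (r x) =
        ∫⁻ x in Set.Ioo (0:ℝ) 1, ∑' k, ENNReal.ofReal (c (k + 1) * x ^ (-v (k + 1))) := by
      refine setLIntegral_congr_fun measurableSet_Ioo fun x hx => ?_
      have h7 := ENNReal.ofReal_tsum_of_nonneg (fun k => hT0 (k + 1) x hx) (hTs x hx)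
      simp only [hr]
      rw [h7]
      simp only [hT]
    rw [h1, lintegral_tsum (fun k => by fun_prop)]
    have hvn : ∀ k, v (k + 1) ≤ 0 := fun k => by
      have h0 : (0:ℝ) ≤ k := by positivity
      linarith [(hv k).2]
    have h2 : ∀ k, ∫⁻ x in Set.Ioo (0:ℝ) 1, ENNReal.ofReal (c (k + 1) * x ^ (-v (k + 1))) =
        ENNReal.ofReal (c (k + 1) * (1 / (-v (k + 1) + 1))) := fun k =>
      lint_rpow (by linarith [hvn k]) (hcb _).1
    simp_rw [h2]
    have hsum : Summable (fun k => c (k + 1) * (1 / (-v (k + 1) + 1))) := by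
      have h3 := ((summable_nat_add_iff 1).2 (hpf 2 one_lt_two).summable).mul_left 2
      refine Summable.of_nonneg_of_le (fun k => ?_) (fun k => ?_) h3
      · exact mul_nonneg (hcb _).1 (one_div_nonneg.2 (by linarith [hvn k]))
      · have h4 := hvn k
        have h5 : 1 / (-v (k + 1) + 1) ≤ 2 * (1 / (2 - v (k + 1))) := by
          rw [mul_one_div, div_le_div_iff₀ (by linarith) (by linarith)]
          linarith
        calc c (k + 1) * (1 / (-v (k + 1) + 1)) ≤ c (k + 1) * (2 * (1 / (2 - v (k + 1)))) :=
              mul_le_mul_of_nonneg_left h5 (hcb _).1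
          _ = _ := by ring
    rw [← ENNReal.ofReal_tsum_of_nonneg (fun k => mul_nonneg (hcb _).1
      (one_div_nonneg.2 (by linarith [hvn k]))) hsum]
    exact ENNReal.ofReal_lt_top
end
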